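/- arXiv:1808.08680 — 7 statements merged into one kernel-verified Lean document; each statement's English description precedes it below -/
import Mathlib

section
/- Let K be a field, V a finite-dimensional K-vector space, u a unipotent automorphism of V, and X = u − 1. Suppose W ⊆ V is a u-invariant subspace with dim(V/W) = 1, and let m ≥ 0 be such that ker(X^m) ⊆ W and ker(X^{m+1}) ⊄ W. Write u_W for the restriction of u to W. Then: (a) if m = 0, then r₁(u_W) = r₁(u) − 1 and r_i(u_W) = r_i(u) for all i ≠ 1; (b) if m ≥ 1, then r_{m+1}(u_W) = r_{m+1}(u) − 1, r_m(u_W) = r_m(u) + 1, and r_i(u_W) = r_i(u) for all i ∉ {m, m+1}. -/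
/-- `jordanBlocks g m = 2·dim ker (g−1)^m − dim ker (g−1)^{m+1} − dim ker (g−1)^{m−1}`,
the number of Jordan blocks of size `m` of a unipotent endomorphism `g`. -/
noncomputable def jordanBlocks {K V : Type*} [Field K] [AddCommGroup V] [Module K V]
    (g : V →ₗ[K] V) (m : ℕ) : ℤ :=
  2 * (Module.finrank K (LinearMap.ker ((g - 1) ^ m)) : ℤ)
    - (Module.finrank K (LinearMap.ker ((g - 1) ^ (m + 1))) : ℤ)
    - (Module.finrank K (LinearMap.ker ((g - 1) ^ (m - 1))) : ℤ)

theorem ker_pow_le_ker_pow_of_le {K V : Type*} [Field K] [AddCommGroup V] [Module K V]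
    (f : V →ₗ[K] V) {i j : ℕ} (hij : i ≤ j) :
    LinearMap.ker (f ^ i) ≤ LinearMap.ker (f ^ j) := by
  intro x hx
  exact Module.End.pow_map_zero_of_le hij hx

theorem coe_restrict_sub_one_pow_apply {K V : Type*} [Field K] [AddCommGroup V] [Module K V]
    (f : V →ₗ[K] V) (W : Submodule K V) (hW : ∀ x ∈ W, f x ∈ W) (i : ℕ) (x : W) :
    ((((f.restrict hW - 1) ^ i) x : W) : V) = ((f - 1) ^ i) (x : V) := by
  induction i generalizing x with
  | zero => simp
  | succ i ih => simp [pow_succ, ih]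

theorem finrank_ker_restrict_sub_one_pow {K V : Type*} [Field K] [AddCommGroup V] [Module K V]
    (f : V →ₗ[K] V) (W : Submodule K V) (hW : ∀ x ∈ W, f x ∈ W) (i : ℕ) :
    Module.finrank K (LinearMap.ker ((f.restrict hW - 1) ^ i)) =
      Module.finrank K (W ⊓ LinearMap.ker ((f - 1) ^ i) : Submodule K V) := by
  have h : LinearMap.ker ((f.restrict hW - 1) ^ i) =
      (LinearMap.ker ((f - 1) ^ i)).comap W.subtype := by
    ext x
    simp [← coe_restrict_sub_one_pow_apply f W hW]
  rw [h, ← Submodule.map_comap_subtype]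
  exact (Submodule.finrank_map_subtype_eq W _).symm

theorem finrank_inf_add_one_of_not_le {K V : Type*} [Field K] [AddCommGroup V] [Module K V]
    [FiniteDimensional K V] {W U : Submodule K V} (hcodim : Module.finrank K (V ⧸ W) = 1)
    (hU : ¬ U ≤ W) :
    Module.finrank K (W ⊓ U : Submodule K V) + 1 = Module.finrank K U := by
  have hlt := Submodule.finrank_lt_finrank_of_lt (left_lt_sup.mpr hU)
  have hle := Submodule.finrank_le (W ⊔ U)
  have hsum := Submodule.finrank_sup_add_finrank_inf_eq W U
  have hquot := W.finrank_quotient_add_finrank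
  omega

theorem stmt1 {K V : Type*} [Field K] [AddCommGroup V] [Module K V] [FiniteDimensional K V]
    (u : V ≃ₗ[K] V) (hu : IsNilpotent (u.toLinearMap - 1))
    (W : Submodule K V) (hW : ∀ x ∈ W, u.toLinearMap x ∈ W)
    (hcodim : Module.finrank K (V ⧸ W) = 1)
    (m : ℕ)
    (h1 : LinearMap.ker ((u.toLinearMap - 1) ^ m) ≤ W)
    (h2 : ¬ LinearMap.ker ((u.toLinearMap - 1) ^ (m + 1)) ≤ W) :
    (m = 0 →
      jordanBlocks (u.toLinearMap.restrict hW) 1 = jordanBlocks u.toLinearMap 1 - 1 ∧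
      ∀ i, 1 ≤ i → i ≠ 1 →
        jordanBlocks (u.toLinearMap.restrict hW) i = jordanBlocks u.toLinearMap i) ∧
    (1 ≤ m →
      jordanBlocks (u.toLinearMap.restrict hW) (m + 1)
          = jordanBlocks u.toLinearMap (m + 1) - 1 ∧
      jordanBlocks (u.toLinearMap.restrict hW) m = jordanBlocks u.toLinearMap m + 1 ∧
      ∀ i, 1 ≤ i → i ≠ m → i ≠ m + 1 →
        jordanBlocks (u.toLinearMap.restrict hW) i = jordanBlocks u.toLinearMap i) := by
  have hlow : ∀ i ≤ m, Module.finrank K (LinearMap.ker ((u.toLinearMap.restrict hW - 1) ^ i)) =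
      Module.finrank K (LinearMap.ker ((u.toLinearMap - 1) ^ i)) := by
    intro i hi
    rw [finrank_ker_restrict_sub_one_pow, inf_eq_right.mpr]
    exact (ker_pow_le_ker_pow_of_le _ hi).trans h1
  have hhigh : ∀ i, m + 1 ≤ i →
      Module.finrank K (LinearMap.ker ((u.toLinearMap.restrict hW - 1) ^ i)) + 1 =
        Module.finrank K (LinearMap.ker ((u.toLinearMap - 1) ^ i)) := by
    intro i hi
    rw [finrank_ker_restrict_sub_one_pow]
    exact finrank_inf_add_one_of_not_le hcodim
      fun h => h2 ((ker_pow_le_ker_pow_of_le _ hi).trans h)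
  unfold jordanBlocks
  refine ⟨?_, fun hm => ⟨?_, ?_, ?_⟩⟩
  · rintro rfl
    refine ⟨?_, fun i hi hne => ?_⟩
    · have a := hlow (1 - 1) (by omega)
      have b := hhigh 1 (by omega)
      have c := hhigh (1 + 1) (by omega)
      omega
    · have a := hhigh (i - 1) (by omega)
      have b := hhigh i (by omega)
      have c := hhigh (i + 1) (by omega)
      omega
  · have a := hlow (m + 1 - 1) (by omega)
    have b := hhigh (m + 1) (by omega)
    have c := hhigh (m + 1 + 1) (by omega)
    omega
  · have a := hlow (m - 1) (by omega)
    have b := hlow m le_rfl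
    have c := hhigh (m + 1) le_rfl
    omega
  · intro i hi hne hne'
    rcases lt_or_gt_of_ne hne with h | h
    · have a := hlow (i - 1) (by omega)
      have b := hlow i (by omega)
      have c := hlow (i + 1) (by omega)
      omega
    · have a := hhigh (i - 1) (by omega)
      have b := hhigh i (by omega)
      have c := hhigh (i + 1) (by omega)
      omega
end

section
/- Let K be a field of characteristic p > 0, let α ≥ 0, and let m, n ≥ 1 and d₁, …, d_t ≥ 1 be integers. For d ≥ 1, let J_d denote the d×d unipotent Jordan block matrix over K (ones on the diagonal and on the superdiagonal). If the Kronecker product J_m ⊗ J_n is similar over K to the block-diagonal matrix with diagonal blocks J_{d₁}, …, J_{d_t}, then J_{p^α m} ⊗ J_{p^α n} is similar over K to the block-diagonal matrix whose diagonal blocks consist of p^α copies of each of J_{p^α d₁}, …, J_{p^α d_t}. -/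
open Kronecker

/-- The `d × d` unipotent Jordan block: ones on the diagonal and the superdiagonal. -/
def jordanBlockMat (K : Type*) [Field K] (d : ℕ) : Matrix (Fin d) (Fin d) K :=
  Matrix.of fun i j => if (j : ℕ) = i ∨ (j : ℕ) = (i : ℕ) + 1 then 1 else 0

/-- Two square matrices (over possibly different index types) are similar over `K`. -/
def MatSimilar {K : Type*} [Field K] {I J : Type*} [Fintype I] [Fintype J]
    [DecidableEq I] [DecidableEq J] (A : Matrix I I K) (B : Matrix J J K) : Prop :=
  ∃ e : I ≃ J, ∃ P : Matrix J J K, IsUnit P ∧ Matrix.reindex e e A = P⁻¹ * B * P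

open Matrix

lemma jordanBlockMat_sub_one_pow (K : Type*) [Field K] (d k : ℕ) :
    (jordanBlockMat K d - 1) ^ k =
      Matrix.of fun i j : Fin d => if (j : ℕ) = i + k then (1 : K) else 0 := by
  induction k with
  | zero => ext i j; simp [Matrix.one_apply, Fin.ext_iff, eq_comm]
  | succ k ih =>
    have h1 : ∀ i j : Fin d, (jordanBlockMat K d - 1) i j = if (j : ℕ) = i + 1 then 1 else 0 := by
      intro i j
      simp only [jordanBlockMat, Matrix.sub_apply, Matrix.of_apply, Matrix.one_apply, Fin.ext_iff]
      split_ifs <;> first | omega | simp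
    rw [pow_succ', ih]
    ext i j
    simp only [Matrix.mul_apply, h1, Matrix.of_apply, ite_mul, one_mul, zero_mul]
    by_cases hi : (i : ℕ) + 1 < d
    · rw [Finset.sum_eq_single ⟨i + 1, hi⟩]
      · simp [add_assoc, add_comm 1 k]
      · intro l _ hl
        rw [if_neg fun h => hl (Fin.ext h)]
      · simp
    · rw [if_neg (by omega)]
      exact Finset.sum_eq_zero fun l _ => if_neg (by omega)

/-- The block-diagonal matrix of unipotent Jordan blocks of sizes `d r`. -/
abbrev jordanSumMat (K : Type*) [Field K] {ι : Type*} [DecidableEq ι] (d : ι → ℕ) :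
    Matrix (Σ r, Fin (d r)) (Σ r, Fin (d r)) K :=
  Matrix.blockDiagonal' fun r => jordanBlockMat K (d r)

section JordanSum

variable {K : Type*} [Field K] {ι : Type*} [DecidableEq ι] {d : ι → ℕ}

lemma jordanSumMat_sub_one_apply (s t : Σ r, Fin (d r)) :
    (jordanSumMat K d - 1) s t = if s.1 = t.1 ∧ (t.2 : ℕ) = s.2 + 1 then 1 else 0 := by
  obtain ⟨r, i⟩ := s
  obtain ⟨r', j⟩ := t
  by_cases h : r = r'
  · subst h
    have := congrFun (congrFun (jordanBlockMat_sub_one_pow K (d r) 1) i) j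
    simpa [Matrix.sub_apply, Matrix.one_apply] using this
  · simp [Matrix.sub_apply, Matrix.blockDiagonal'_apply_ne _ _ _ h, h]

variable [Fintype ι]

lemma jordanSumMat_sub_one_pow_mulVec (r : ι) (k : ℕ) :
    ((jordanSumMat K d - 1) ^ k *ᵥ fun s => if s.1 = r ∧ (s.2 : ℕ) + 1 = d r then 1 else 0) =
      fun s => if s.1 = r ∧ (s.2 : ℕ) + 1 + k = d r then 1 else 0 := by
  induction k with
  | zero => simp
  | succ k ih =>
    rw [pow_succ', ← Matrix.mulVec_mulVec, ih]
    ext ⟨r', i⟩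
    simp only [Matrix.mulVec, dotProduct, jordanSumMat_sub_one_apply, ite_mul, one_mul, zero_mul]
    by_cases hi : (i : ℕ) + 1 < d r'
    · rw [Finset.sum_eq_single ⟨r', ⟨i + 1, hi⟩⟩]
      · simp [show (i : ℕ) + 1 + 1 + k = i + 1 + (k + 1) by omega]
      · rintro ⟨r'', l⟩ _ hl
        rw [if_neg]
        rintro ⟨rfl, h⟩
        exact hl (by simp [← h])
      · simp
    · rw [Finset.sum_eq_zero]
      · rw [if_neg]
        rintro ⟨rfl, h⟩
        omega
      · rintro ⟨r'', l⟩ _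
        rw [if_neg]
        rintro ⟨rfl, h : (l : ℕ) = i + 1⟩
        omega

lemma pow_mul_eq_mul_pow_of_mul_eq {I J : Type*} [Fintype I] [Fintype J]
    [DecidableEq I] [DecidableEq J] {A : Matrix I I K} {B : Matrix J J K} {Q : Matrix I J K}
    (h : A * Q = Q * B) (k : ℕ) : A ^ k * Q = Q * B ^ k := by
  induction k with
  | zero => simp
  | succ k ih => rw [pow_succ, Matrix.mul_assoc, h, ← Matrix.mul_assoc, ih, Matrix.mul_assoc,
      ← pow_succ]

lemma sub_one_mul_eq_mul_sub_one_iff {I J : Type*} [Fintype I] [Fintype J]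
    [DecidableEq I] [DecidableEq J] {A : Matrix I I K} {B : Matrix J J K} {Q : Matrix I J K} :
    (A - 1) * Q = Q * (B - 1) ↔ A * Q = Q * B := by
  simp [Matrix.sub_mul, Matrix.mul_sub]

/-- A matrix is similar to a sum of unipotent Jordan blocks of sizes `d r` iff the sizes add up
correctly and the space is generated, as a module over the polynomials in the matrix, by vectors
`v r` killed by `(A - 1) ^ d r`. -/
lemma matSimilar_jordanSumMat_iff {I : Type*} [Fintype I] [DecidableEq I] {A : Matrix I I K} :
    MatSimilar A (jordanSumMat K d) ↔ Fintype.card I = ∑ r, d r ∧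
      ∃ v : ι → I → K, (∀ r, (A - 1) ^ d r *ᵥ v r = 0) ∧
        ∀ S : Submodule K (I → K), (∀ w ∈ S, A *ᵥ w ∈ S) → (∀ r, v r ∈ S) → S = ⊤ := by
  constructor
  · rintro ⟨e, P, hP, h⟩
    have hdet := (Matrix.isUnit_iff_isUnit_det P).1 hP
    refine ⟨by simpa using Fintype.card_congr e, ?_⟩
    set Q : Matrix I (Σ r, Fin (d r)) K := P⁻¹.submatrix e id with hQ
    have hAQ : A * Q = Q * jordanSumMat K d := by
      have h2 : Matrix.reindex e e A * P⁻¹ = P⁻¹ * jordanSumMat K d := by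
        rw [h, Matrix.mul_assoc, Matrix.mul_nonsing_inv _ hdet, Matrix.mul_one]
      have h3 := congrArg (fun M => M.submatrix e id) h2
      simp only [Matrix.reindex_apply] at h3
      rw [Matrix.submatrix_mul _ _ _ e _ e.bijective,
        Matrix.submatrix_mul _ _ _ id _ Function.bijective_id] at h3
      simpa [hQ] using h3
    have hAQ1 := fun k => pow_mul_eq_mul_pow_of_mul_eq (sub_one_mul_eq_mul_sub_one_iff.2 hAQ) k
    have hsurj : ∀ w, ∃ u, Q *ᵥ u = w := by
      intro w
      refine ⟨P *ᵥ (w ∘ e.symm), ?_⟩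
      have h4 : P⁻¹ *ᵥ (P *ᵥ (w ∘ e.symm)) = w ∘ e.symm := by
        rw [Matrix.mulVec_mulVec, Matrix.nonsing_inv_mul _ hdet, Matrix.one_mulVec]
      ext i
      simpa [hQ, Matrix.mulVec, dotProduct] using congrFun h4 (e i)
    refine ⟨fun r => Q *ᵥ fun s => if s.1 = r ∧ (s.2 : ℕ) + 1 = d r then 1 else 0,
      fun r => ?_, fun S hS hv => ?_⟩
    · rw [Matrix.mulVec_mulVec, hAQ1, ← Matrix.mulVec_mulVec, jordanSumMat_sub_one_pow_mulVec]
      rw [show (fun s : Σ r, Fin (d r) => if s.1 = r ∧ (s.2 : ℕ) + 1 + d r = d r then (1 : K) else 0)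
        = 0 from ?_, Matrix.mulVec_zero]
      ext s
      exact if_neg (by omega)
    · have hpow : ∀ k, ∀ w ∈ S, (A - 1) ^ k *ᵥ w ∈ S := by
        intro k
        induction k with
        | zero => simp
        | succ k ih =>
          intro w hw
          rw [pow_succ, ← Matrix.mulVec_mulVec, Matrix.sub_mulVec, Matrix.one_mulVec]
          exact ih _ (S.sub_mem (hS w hw) hw)
      rw [eq_top_iff]
      rintro w -
      obtain ⟨u, rfl⟩ := hsurj w
      suffices h5 : ∀ s, Q *ᵥ Pi.single s 1 ∈ S by
        rw [pi_eq_sum_univ' u, Matrix.mulVec_sum]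
        refine S.sum_mem fun s _ => ?_
        rw [Matrix.mulVec_smul]
        refine S.smul_mem _ ?_
        convert h5 s using 2
      rintro ⟨r, i⟩
      have h6 := hpow (d r - 1 - i) _ (hv r)
      rw [Matrix.mulVec_mulVec, hAQ1, ← Matrix.mulVec_mulVec,
        jordanSumMat_sub_one_pow_mulVec] at h6
      suffices h7 : (Pi.single ⟨r, i⟩ 1 : (Σ r, Fin (d r)) → K) =
          fun s => if s.1 = r ∧ (s.2 : ℕ) + 1 + (d r - 1 - i) = d r then 1 else 0 by
        rw [h7]
        exact h6
      funext ⟨r', j⟩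
      rw [Pi.single_apply]
      refine if_congr ?_ rfl rfl
      constructor
      · rintro h
        cases h
        refine ⟨rfl, ?_⟩
        simp only
        omega
      · rintro ⟨rfl, h⟩
        simp only at h
        congr 1
        ext
        omega
  · rintro ⟨hcard, v, hv0, hgen⟩
    have e : I ≃ Σ r, Fin (d r) := Fintype.equivOfCardEq (by simpa using hcard)
    set Q : Matrix I (Σ r, Fin (d r)) K :=
      Matrix.of fun i s => ((A - 1) ^ (d s.1 - 1 - s.2) *ᵥ v s.1) i with hQ
    have hAQ : A * Q = Q * jordanSumMat K d := by
      rw [← sub_one_mul_eq_mul_sub_one_iff]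
      ext i ⟨r, j⟩
      have hl : ((A - 1) * Q : Matrix _ _ K) i ⟨r, j⟩ = ((A - 1) ^ (d r - j) *ᵥ v r) i := by
        have : d r - j = (d r - 1 - j) + 1 := by omega
        rw [this, pow_succ', ← Matrix.mulVec_mulVec]
        rfl
      rw [hl]
      simp only [Matrix.mul_apply, jordanSumMat_sub_one_apply, mul_ite, mul_one, mul_zero]
      by_cases hj : (j : ℕ) = 0
      · rw [Finset.sum_eq_zero]
        · simp [hj, hv0]
        · intro s _
          exact if_neg (by omega)
      · rw [Finset.sum_eq_single ⟨r, ⟨j - 1, by omega⟩⟩]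
        · have : d r - 1 - ((j : ℕ) - 1) = d r - j := by omega
          simp only [hQ, Matrix.of_apply, this]
          rw [if_pos]
          simp only [true_and]
          omega
        · rintro ⟨r', l⟩ _ hl
          refine if_neg ?_
          rintro ⟨rfl, h⟩
          refine hl ?_
          simp only at h
          congr 1
          ext
          simp only
          omega
        · simp
    have hsurj : LinearMap.range Q.mulVecLin = ⊤ := by
      refine hgen _ ?_ fun r => ?_
      · rintro _ ⟨u, rfl⟩
        exact ⟨jordanSumMat K d *ᵥ u, by simp [Matrix.mulVec_mulVec, hAQ]⟩
      · by_cases hr : d r = 0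
        · have := hv0 r
          rw [hr, pow_zero, Matrix.one_mulVec] at this
          rw [this]
          exact Submodule.zero_mem _
        · refine ⟨Pi.single ⟨r, ⟨d r - 1, by omega⟩⟩ 1, ?_⟩
          ext i
          simp [hQ]
    set Q' := Q.submatrix e.symm id with hQ'
    have hunit : IsUnit Q' := by
      rw [← Matrix.mulVec_surjective_iff_isUnit]
      intro w
      obtain ⟨u, hu⟩ := LinearMap.range_eq_top.1 hsurj (w ∘ e)
      refine ⟨u, ?_⟩
      ext s
      simpa [hQ', Matrix.mulVec, dotProduct] using congrFun hu (e.symm s)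
    have hdet := (Matrix.isUnit_iff_isUnit_det Q').1 hunit
    refine ⟨e, Q'⁻¹, (Matrix.isUnit_nonsing_inv_iff).2 hunit, ?_⟩
    have h3 : Matrix.reindex e e A * Q' = Q' * jordanSumMat K d := by
      have := congrArg (fun M => M.submatrix e.symm id) hAQ
      rw [Matrix.submatrix_mul _ _ _ e.symm _ e.symm.bijective,
        Matrix.submatrix_mul _ _ _ id _ Function.bijective_id] at this
      simpa [hQ'] using this
    rw [Matrix.nonsing_inv_nonsing_inv _ hdet, ← h3, Matrix.mul_assoc,
      Matrix.mul_nonsing_inv _ hdet, Matrix.mul_one]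

end JordanSum

section Frobenius

variable (K : Type*) [Field K]

/-- The embedding of `K ^ m` into `K ^ (q * m)` intertwining the nilpotent shift with the `q`-th
power of the nilpotent shift. -/
def stretchMat (q m : ℕ) : Matrix (Fin (q * m)) (Fin m) K :=
  Matrix.of fun i a => if (i : ℕ) + 1 = q * (a + 1) then 1 else 0

lemma shift_pow_mul_stretchMat (q m : ℕ) :
    (jordanBlockMat K (q * m) - 1) ^ q * stretchMat K q m =
      stretchMat K q m * (jordanBlockMat K m - 1) := by
  have h1 := jordanBlockMat_sub_one_pow K m 1
  rw [pow_one] at h1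
  rw [jordanBlockMat_sub_one_pow, h1]
  ext i a
  simp only [stretchMat, Matrix.mul_apply, Matrix.of_apply, ite_mul, one_mul, zero_mul]
  have hl : ∑ l : Fin (q * m), (if (l : ℕ) = i + q then
      if (l : ℕ) + 1 = q * (a + 1) then (1 : K) else 0 else 0) =
      if (i : ℕ) + 1 = q * a then 1 else 0 := by
    have ha : q * ((a : ℕ) + 1) ≤ q * m := Nat.mul_le_mul_left q a.2
    rw [mul_add, mul_one] at *
    by_cases h : (i : ℕ) + 1 = q * a
    · rw [if_pos h, Finset.sum_eq_single ⟨i + q, by omega⟩]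
      · rw [if_pos rfl, if_pos (by simp only; omega)]
      · intro l _ hl
        exact if_neg fun h => hl (Fin.ext h)
      · simp
    · rw [if_neg h]
      refine Finset.sum_eq_zero fun l _ => ?_
      split_ifs <;> first | omega | rfl
  rw [hl]
  by_cases h : (i : ℕ) + 1 = q * a
  · have ha : (a : ℕ) ≠ 0 := by rintro h0; simp [h0] at h
    rw [if_pos h, Finset.sum_eq_single ⟨a - 1, by omega⟩]
    · have : (a : ℕ) - 1 + 1 = a := by omega
      simp [this, h]
    · intro l _ hl
      split_ifs with h2 h3
      · exact absurd (Fin.ext (by simp only; omega)) hl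
      · rfl
      · rfl
    · simp
  · rw [if_neg h]
    symm
    refine Finset.sum_eq_zero fun l _ => ?_
    split_ifs with h2 h3
    · exact absurd (h2.trans (by rw [h3])) h
    · rfl
    · rfl

variable (p : ℕ) [Fact p.Prime] [CharP K p]

lemma jordanBlockMat_sub_one_pow_char_pow {d : ℕ} (hd : 1 ≤ d) (α : ℕ) :
    (jordanBlockMat K d - 1) ^ p ^ α = jordanBlockMat K d ^ p ^ α - 1 := by
  have : Nonempty (Fin d) := ⟨⟨0, hd⟩⟩
  rw [sub_pow_char_pow_of_commute (p := p) _ (Commute.one_right _), one_pow]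

lemma jordanBlockMat_pow_char_pow_eq_one {d : ℕ} (hd : 1 ≤ d) :
    jordanBlockMat K d ^ p ^ d = 1 := by
  rw [← sub_eq_zero, ← jordanBlockMat_sub_one_pow_char_pow K p hd, jordanBlockMat_sub_one_pow]
  ext i j
  have := Nat.lt_pow_self (n := d) (Fact.out : p.Prime).one_lt
  exact if_neg (by omega)

lemma jordanBlockMat_pow_mul_stretchMat {m : ℕ} (hm : 1 ≤ m) (α : ℕ) :
    jordanBlockMat K (p ^ α * m) ^ p ^ α * stretchMat K (p ^ α) m =
      stretchMat K (p ^ α) m * jordanBlockMat K m := by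
  have hq : 0 < p ^ α := pow_pos (Fact.out : p.Prime).pos α
  rw [← sub_one_mul_eq_mul_sub_one_iff, ← shift_pow_mul_stretchMat K,
    jordanBlockMat_sub_one_pow_char_pow K p (Nat.mul_pos hq hm)]

end Frobenius

lemma eq_top_of_shift_invariant (K : Type*) [Field K] {M N : ℕ} (hM : 1 ≤ M) (hN : 1 ≤ N)
    (S : Submodule K (Fin M × Fin N → K))
    (hx : ∀ w ∈ S, ((jordanBlockMat K M - 1) ⊗ₖ (1 : Matrix (Fin N) (Fin N) K)) *ᵥ w ∈ S)
    (hy : ∀ w ∈ S, ((1 : Matrix (Fin M) (Fin M) K) ⊗ₖ (jordanBlockMat K N - 1)) *ᵥ w ∈ S)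
    (hlast : Pi.single (⟨M - 1, by omega⟩, ⟨N - 1, by omega⟩) 1 ∈ S) : S = ⊤ := by
  have hs : ∀ {d : ℕ} (i j : Fin d), (jordanBlockMat K d - 1) i j =
      if (j : ℕ) = i + 1 then 1 else 0 := by
    intro d i j
    have := congrFun (congrFun (jordanBlockMat_sub_one_pow K d 1) i) j
    rwa [pow_one] at this
  have h1 : ∀ a, ∀ ha : a < M, Pi.single (⟨M - 1 - a, by omega⟩, ⟨N - 1, by omega⟩) 1 ∈ S := by
    intro a
    induction a with
    | zero => exact fun _ => hlast
    | succ a ih =>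
      intro ha
      convert hx _ (ih (by omega)) using 1
      ext ⟨i, j⟩
      have : M - 1 - a = i + 1 ↔ (i : ℕ) = M - 1 - (a + 1) := by omega
      simp [Matrix.kroneckerMap_apply, hs, Pi.single_apply, Fin.ext_iff, Matrix.one_apply, this,
        ← ite_and, and_comm]
  have h2 : ∀ b, ∀ hb : b < N, ∀ i : Fin M, Pi.single (i, ⟨N - 1 - b, by omega⟩) 1 ∈ S := by
    intro b
    induction b with
    | zero =>
      intro _ i
      convert h1 (M - 1 - i) (by omega) using 4
      · omega
      · simp
    | succ b ih =>
      intro hb i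
      convert hy _ (ih (by omega) i) using 1
      ext ⟨i', j⟩
      have : N - 1 - b = j + 1 ↔ (j : ℕ) = N - 1 - (b + 1) := by omega
      simp [Matrix.kroneckerMap_apply, hs, Pi.single_apply, Fin.ext_iff, Matrix.one_apply, this,
        ← ite_and, and_comm]
  rw [eq_top_iff]
  intro w _
  rw [← Finset.univ_sum_single w]
  refine S.sum_mem fun ⟨i, j⟩ _ => ?_
  have h3 : Pi.single (i, j) 1 ∈ S := by
    convert h2 (N - 1 - j) (by omega) i
    omega
  convert S.smul_mem (w (i, j)) h3 using 1
  rw [← Pi.single_smul, smul_eq_mul, mul_one]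

theorem stmt3 {K : Type*} [Field K] (p : ℕ) [Fact p.Prime] [CharP K p]
    (α m n : ℕ) (hm : 1 ≤ m) (hn : 1 ≤ n)
    {t : ℕ} (d : Fin t → ℕ) (hd : ∀ r, 1 ≤ d r)
    (h : MatSimilar (jordanBlockMat K m ⊗ₖ jordanBlockMat K n)
      (Matrix.blockDiagonal' fun r : Fin t => jordanBlockMat K (d r))) :
    MatSimilar (jordanBlockMat K (p ^ α * m) ⊗ₖ jordanBlockMat K (p ^ α * n))
      (Matrix.blockDiagonal' fun r : Fin t × Fin (p ^ α) =>
        jordanBlockMat K (p ^ α * d r.1)) := by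
  obtain ⟨hcard, v, hv0, hgen⟩ := matSimilar_jordanSumMat_iff.1 h
  refine matSimilar_jordanSumMat_iff.2 ⟨?_, ?_⟩
  · simp only [Fintype.card_prod, Fintype.card_fin] at hcard ⊢
    rw [Fintype.sum_prod_type]
    simp only [Finset.sum_const, Finset.card_univ, Fintype.card_fin, smul_eq_mul]
    rw [← Finset.mul_sum, ← Finset.mul_sum, ← hcard]
    ring
  have hq : 0 < p ^ α := pow_pos (Fact.out : p.Prime).pos α
  set q := p ^ α
  have hM : 1 ≤ q * m := Nat.mul_pos hq hm
  have hN : 1 ≤ q * n := Nat.mul_pos hq hn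
  have : Nonempty (Fin (q * m) × Fin (q * n)) := ⟨⟨0, hM⟩, ⟨0, hN⟩⟩
  set A := jordanBlockMat K m ⊗ₖ jordanBlockMat K n with hA
  set x := (jordanBlockMat K (q * m) - 1) ⊗ₖ (1 : Matrix (Fin (q * n)) (Fin (q * n)) K) with hx
  set y := (1 : Matrix (Fin (q * m)) (Fin (q * m)) K) ⊗ₖ jordanBlockMat K (q * n) with hy
  set g := jordanBlockMat K (q * m) ⊗ₖ jordanBlockMat K (q * n) with hg
  set Φ := stretchMat K q m ⊗ₖ stretchMat K q n with hΦ
  set x₀ := (jordanBlockMat K m - 1) ⊗ₖ (1 : Matrix (Fin n) (Fin n) K) with hx₀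
  have hx1 : x + 1 = jordanBlockMat K (q * m) ⊗ₖ 1 := by
    rw [hx, ← Matrix.one_kronecker_one, ← Matrix.add_kronecker, sub_add_cancel]
  have hxg : Commute x g := by
    rw [Commute, SemiconjBy, hx, hg, ← Matrix.mul_kronecker_mul, ← Matrix.mul_kronecker_mul,
      sub_mul, mul_sub, one_mul, mul_one, one_mul, mul_one]
  have hpowk : ∀ {a b : ℕ} (B : Matrix (Fin a) (Fin a) K) (C : Matrix (Fin b) (Fin b) K) (k : ℕ),
      (B ⊗ₖ C) ^ k = (B ^ k) ⊗ₖ (C ^ k) := by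
    intro a b B C k
    induction k with
    | zero => simp
    | succ k ih => rw [pow_succ, ih, ← Matrix.mul_kronecker_mul, ← pow_succ, ← pow_succ]
  have hgΦ : g ^ q * Φ = Φ * A := by
    rw [hg, hpowk, hΦ, hA, ← Matrix.mul_kronecker_mul, ← Matrix.mul_kronecker_mul,
      jordanBlockMat_pow_mul_stretchMat K p hm, jordanBlockMat_pow_mul_stretchMat K p hn]
  have hxΦ : x ^ q * Φ = Φ * x₀ := by
    rw [hx, hpowk, hΦ, hx₀, ← Matrix.mul_kronecker_mul, ← Matrix.mul_kronecker_mul,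
      shift_pow_mul_stretchMat K, one_pow, Matrix.one_mul, Matrix.mul_one]
  have hyx : y = g * (x + 1) ^ (p ^ (q * m) - 1) := by
    have hp : 1 ≤ p ^ (q * m) := Nat.one_le_pow _ _ (Fact.out : p.Prime).pos
    rw [hx1, hg, hpowk, ← Matrix.mul_kronecker_mul, ← pow_succ', Nat.sub_add_cancel hp,
      jordanBlockMat_pow_char_pow_eq_one K p hM, one_pow, mul_one]
  have hgq : (g - 1) ^ q = g ^ q - 1 := by
    rw [sub_pow_char_pow_of_commute (p := p) _ (Commute.one_right _), one_pow]
  refine ⟨fun r => x ^ (r.2 : ℕ) *ᵥ (Φ *ᵥ v r.1), fun r => ?_, fun S hS hv => ?_⟩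
  · have h1 : (g ^ q - 1) ^ d r.1 * Φ = Φ * (A - 1) ^ d r.1 :=
      pow_mul_eq_mul_pow_of_mul_eq (sub_one_mul_eq_mul_sub_one_iff.2 hgΦ) _
    have h2 : Commute ((g ^ q - 1) ^ d r.1) (x ^ (r.2 : ℕ)) :=
      (((hxg.symm.pow_left q).sub_left (Commute.one_left _)).pow_left _).pow_right _
    rw [pow_mul, hgq, Matrix.mulVec_mulVec, Matrix.mulVec_mulVec,
      h2.eq, Matrix.mul_assoc, h1, ← Matrix.mulVec_mulVec, ← Matrix.mulVec_mulVec, hv0, Matrix.mulVec_zero,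
      Matrix.mulVec_zero]
  have hgS : ∀ k, ∀ w ∈ S, g ^ k *ᵥ w ∈ S := by
    intro k
    induction k with
    | zero => simp
    | succ k ih =>
      intro w hw
      rw [pow_succ, ← Matrix.mulVec_mulVec]
      exact ih _ (hS w hw)
  have hlow : ∀ j < q, ∀ w, x ^ j *ᵥ (Φ *ᵥ w) ∈ S := by
    intro j hj w
    have htop : S.comap ((x ^ j).mulVecLin ∘ₗ Φ.mulVecLin) = ⊤ := by
      refine hgen _ (fun u hu => ?_) fun r => by simpa using hv (r, ⟨j, hj⟩)
      have h1 := hgS q _ hu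
      have h2 : g ^ q * (x ^ j * Φ) = x ^ j * (Φ * A) := by
        rw [← Matrix.mul_assoc, ((hxg.symm.pow_left q).pow_right j).eq, Matrix.mul_assoc, hgΦ]
      simpa [Matrix.mulVec_mulVec, h2, Matrix.mul_assoc] using h1
    have : w ∈ S.comap ((x ^ j).mulVecLin ∘ₗ Φ.mulVecLin) := htop ▸ Submodule.mem_top
    simpa using this
  have hall : ∀ j w, x ^ j *ᵥ (Φ *ᵥ w) ∈ S := by
    intro j w
    have h1 : x ^ j * Φ = x ^ (j % q) * (Φ * x₀ ^ (j / q)) := by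
      rw [← pow_mul_eq_mul_pow_of_mul_eq hxΦ, ← Matrix.mul_assoc, ← pow_mul, ← pow_add, Nat.mod_add_div]
    rw [Matrix.mulVec_mulVec, h1, ← Matrix.mulVec_mulVec, ← Matrix.mulVec_mulVec]
    exact hlow _ (Nat.mod_lt _ hq) _
  let T : Submodule K (Fin (q * m) × Fin (q * n) → K) := ⨅ k, S.comap (x ^ k).mulVecLin
  have hT : ∀ w, w ∈ T ↔ ∀ k, x ^ k *ᵥ w ∈ S := by
    intro w
    simp [T, Submodule.mem_iInf]
  have hTx : ∀ w ∈ T, x *ᵥ w ∈ T := by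
    intro w hw
    rw [hT] at hw ⊢
    intro k
    rw [Matrix.mulVec_mulVec, ← pow_succ]
    exact hw _
  have hTg : ∀ w ∈ T, g *ᵥ w ∈ T := by
    intro w hw
    rw [hT] at hw ⊢
    intro k
    rw [Matrix.mulVec_mulVec, (hxg.pow_left k).eq, ← Matrix.mulVec_mulVec]
    exact hS _ (hw k)
  have hTx1 : ∀ k, ∀ w ∈ T, (x + 1) ^ k *ᵥ w ∈ T := by
    intro k
    induction k with
    | zero => simp
    | succ k ih =>
      intro w hw
      rw [pow_succ, ← Matrix.mulVec_mulVec, Matrix.add_mulVec, Matrix.one_mulVec]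
      exact ih _ (T.add_mem (hTx w hw) hw)
  have hTy : ∀ w ∈ T, (y - 1) *ᵥ w ∈ T := by
    intro w hw
    rw [Matrix.sub_mulVec, Matrix.one_mulVec, hyx, ← Matrix.mulVec_mulVec]
    exact T.sub_mem (hTg _ (hTx1 _ _ hw)) hw
  have hT_top : T = ⊤ := eq_top_of_shift_invariant K hM hN T hTx (by
    intro w hw
    have : (1 : Matrix (Fin (q * m)) (Fin (q * m)) K) ⊗ₖ (jordanBlockMat K (q * n) - 1) = y - 1 := by
      rw [hy, eq_sub_iff_add_eq, ← Matrix.one_kronecker_one, ← Matrix.kronecker_add,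
        sub_add_cancel]
    rw [this]
    exact hTy w hw) (by
    rw [hT]
    intro k
    have := hall k (Pi.single (⟨m - 1, by omega⟩, ⟨n - 1, by omega⟩) 1)
    convert this using 2
    ext ⟨i, j⟩
    have hi : (i : ℕ) = q * m - 1 ↔ (i : ℕ) + 1 = q * m := by omega
    have hj : (j : ℕ) = q * n - 1 ↔ (j : ℕ) + 1 = q * n := by omega
    simp [hΦ, stretchMat, Pi.single_apply, Fin.ext_iff, hi, hj, Nat.sub_add_cancel hm,
      Nat.sub_add_cancel hn, ← ite_and, and_comm])
  rw [eq_top_iff]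
  intro w _
  have h1 : w ∈ T := hT_top ▸ Submodule.mem_top
  simpa using (hT w).1 h1 0
end

section
/- Let K be a field of characteristic p > 0, n ≥ 1, and let u be the unipotent endomorphism of V = K^n given by a single Jordan block of size n. Let α = ν_p(n) be the p-adic valuation of n, and let g = u ⊗ u acting on V ⊗ V. Then r_m(g) = 0 for all 1 ≤ m < p^α, and r_{p^α}(g) = p^α. In other words, the smallest Jordan block size of u ⊗ u on V ⊗ V is p^α, occurring with multiplicity p^α. -/
open Polynomial TensorProduct

section FiniteDimensional

variable {K B : Type*} [Field K] [CommRing B] [Algebra K B]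

theorem finrank_ker_mulLeft_eq_finrank_quotient [FiniteDimensional K B] (b : B) :
    Module.finrank K (LinearMap.ker (LinearMap.mulLeft K b)) =
      Module.finrank K (B ⧸ Ideal.span {b}) := by
  have hrange : LinearMap.range (LinearMap.mulLeft K b) =
      (Ideal.span {b} : Ideal B).restrictScalars K := by
    ext y
    simp [Ideal.mem_span_singleton, dvd_def, eq_comm]
  have h₁ := LinearMap.finrank_range_add_finrank_ker (LinearMap.mulLeft K b)
  have h₂ := Submodule.finrank_quotient_add_finrank
    ((Ideal.span {b} : Ideal B).restrictScalars K)
  rw [hrange] at h₁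
  have h₃ : Module.finrank K (B ⧸ (Ideal.span {b} : Ideal B).restrictScalars K) =
    Module.finrank K (B ⧸ Ideal.span {b}) := rfl
  omega

theorem finrank_quotient_sup_span (I : Ideal B) (a : B) :
    Module.finrank K ((B ⧸ I) ⧸ Ideal.span {Ideal.Quotient.mk I a}) =
      Module.finrank K (B ⧸ I ⊔ Ideal.span {a}) := by
  have h : Ideal.span {Ideal.Quotient.mk I a} =
      (Ideal.span {a}).map (Ideal.Quotient.mkₐ K I) := by
    rw [Ideal.map_span, Set.image_singleton, Ideal.Quotient.mkₐ_eq_mk]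
  rw [h]
  exact (DoubleQuot.quotQuotEquivQuotSupₐ K I _).toLinearEquiv.finrank_eq

theorem finrank_quotient_span_singleton_mul {a : B} (ha : IsLeftRegular a) (I : Ideal B)
    [FiniteDimensional K (B ⧸ Ideal.span {a} * I)] :
    Module.finrank K (B ⧸ Ideal.span {a} * I) =
      Module.finrank K (B ⧸ Ideal.span {a}) + Module.finrank K (B ⧸ I) := by
  let π : (B ⧸ Ideal.span {a} * I) →ₗ[K] B ⧸ Ideal.span {a} :=
    (Ideal.Quotient.factorₐ K Ideal.mul_le_left).toLinearMap
  have hπ : Function.Surjective π := Ideal.Quotient.factor_surjective Ideal.mul_le_left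
  let ψ : B →ₗ[K] B ⧸ Ideal.span {a} * I :=
    (Ideal.Quotient.mkₐ K (Ideal.span {a} * I)).toLinearMap ∘ₗ LinearMap.mulLeft K a
  have hker : LinearMap.ker ψ = I.restrictScalars K := by
    ext y
    simp only [ψ, LinearMap.mem_ker, LinearMap.comp_apply, LinearMap.mulLeft_apply,
      AlgHom.toLinearMap_apply, Ideal.Quotient.mkₐ_eq_mk, Ideal.Quotient.eq_zero_iff_mem,
      Ideal.mem_span_singleton_mul, Submodule.restrictScalars_mem]
    exact ⟨fun ⟨z, hz, h⟩ ↦ ha h ▸ hz, fun h ↦ ⟨y, h, rfl⟩⟩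
  have hrange : LinearMap.range ψ = LinearMap.ker π := by
    ext y
    obtain ⟨y, rfl⟩ := Ideal.Quotient.mk_surjective y
    have : π (Ideal.Quotient.mk _ y) = Ideal.Quotient.mk _ y := rfl
    rw [LinearMap.mem_ker, this, Ideal.Quotient.eq_zero_iff_mem, Ideal.mem_span_singleton]
    constructor
    · rintro ⟨z, hz⟩
      have := (Ideal.Quotient.eq (I := Ideal.span {a} * I)).1 hz
      have := Ideal.mem_span_singleton.1 (Ideal.mul_le_left this)
      simpa using (dvd_sub_right (dvd_mul_right a z)).1 this
    · rintro ⟨z, rfl⟩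
      exact ⟨z, rfl⟩
  have h₁ := LinearMap.finrank_range_add_finrank_ker π
  rw [LinearMap.range_eq_top.2 hπ, finrank_top, ← hrange,
    ← ψ.quotKerEquivRange.finrank_eq, hker] at h₁
  exact h₁.symm

end FiniteDimensional

section Cyclic

variable {K V : Type*} [Field K] [AddCommGroup V] [Module K V]

theorem exists_linearEquiv_adjoinRoot_X_pow [FiniteDimensional K V] {n : ℕ}
    (hdim : Module.finrank K V = n) {N : Module.End K V} (hN : N ^ n = 0)
    (hN' : N ^ (n - 1) ≠ 0) :
    ∃ φ : AdjoinRoot (X ^ n : K[X]) ≃ₗ[K] V, ∀ r, φ (AdjoinRoot.root _ * r) = N (φ r) := by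
  obtain ⟨e, he⟩ : ∃ e, (N ^ (n - 1)) e ≠ 0 := by
    by_contra! h
    exact hN' (LinearMap.ext h)
  let θ : AdjoinRoot (X ^ n : K[X]) →ₐ[K] Module.End K V :=
    Ideal.Quotient.liftₐ _ (aeval N) fun f hf ↦ by
      obtain ⟨g, rfl⟩ := Ideal.mem_span_singleton.1 hf
      simp [hN]
  have hθ (f : K[X]) : θ (AdjoinRoot.mk _ f) = aeval N f := rfl
  let φ : AdjoinRoot (X ^ n : K[X]) →ₗ[K] V := LinearMap.applyₗ e ∘ₗ θ.toLinearMap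
  have hφ (r) : φ r = θ r e := rfl
  have hinj : Function.Injective φ := by
    rw [← LinearMap.ker_eq_bot, LinearMap.ker_eq_bot']
    intro r hr
    obtain ⟨f, rfl⟩ := AdjoinRoot.mk_surjective r
    rw [hφ, hθ] at hr
    classical
    obtain ⟨k, hk, h⟩ := (dvd_prime_pow prime_X n).1 (EuclideanDomain.gcd_dvd_right f (X ^ n))
    have hNk : (N ^ k) e = 0 := by
      obtain ⟨c, hc⟩ := h.dvd_dvd.1
      have h₁ := congr_arg (aeval N) hc
      rw [EuclideanDomain.gcd_eq_gcd_ab, mul_comm f] at h₁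
      simp only [map_mul, map_add, map_pow, aeval_X, hN, zero_mul, add_zero] at h₁
      rw [h₁, ← map_mul, ← map_mul, mul_right_comm, map_mul, Module.End.mul_apply, hr, map_zero]
    have hkn : k = n := by
      by_contra hne
      refine he ?_
      rw [← Nat.sub_add_cancel (show k ≤ n - 1 by omega), pow_add, Module.End.mul_apply, hNk,
        map_zero]
    exact AdjoinRoot.mk_eq_zero.2
      ((hkn ▸ h.dvd_dvd.2).trans (EuclideanDomain.gcd_dvd_left f (X ^ n)))
  have hfin : Module.finrank K (AdjoinRoot (X ^ n : K[X])) = Module.finrank K V := by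
    rw [hdim]
    exact finrank_quotient_span_eq_natDegree.trans (natDegree_X_pow n)
  have : FiniteDimensional K (AdjoinRoot (X ^ n : K[X])) := .of_injective φ hinj
  refine ⟨LinearEquiv.ofInjectiveOfFinrankEq φ hinj hfin, fun r ↦ ?_⟩
  change θ _ e = N (θ r e)
  rw [map_mul, ← AdjoinRoot.mk_X, hθ, aeval_X, Module.End.mul_apply]

end Cyclic

section TruncatedPolynomial

variable (K : Type*) [Field K] (n : ℕ)

theorem finrank_quotient_root_pow {k : ℕ} (hk : k ≤ n) :
    Module.finrank K (AdjoinRoot (X ^ n : K[X]) ⧸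
      Ideal.span {AdjoinRoot.root (X ^ n : K[X]) ^ k}) = k := by
  have h := finrank_quotient_sup_span (K := K) (Ideal.span {(X ^ n : K[X])}) (X ^ k)
  rw [sup_eq_right.2 (Ideal.span_singleton_le_span_singleton.2 (pow_dvd_pow X hk)),
    finrank_quotient_span_eq_natDegree, natDegree_X_pow, map_pow] at h
  exact h

/-- Base change of the truncated polynomial ring `K[X] / (X ^ n)` along `K → R`. -/
noncomputable def adjoinRootTensorEquiv (R : Type*) [CommRing R] [Algebra K R] :
    R ⊗[K] AdjoinRoot (X ^ n : K[X]) ≃ₐ[K] AdjoinRoot (X ^ n : R[X]) :=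
  ((AdjoinRoot.tensorAlgEquiv (T := R) (X ^ n : K[X]) (X ^ n) (by simp)).restrictScalars K).trans
    (AdjoinRoot.mapAlgEquiv (Algebra.TensorProduct.rid K K R) _ _ (by simp))

theorem adjoinRootTensorEquiv_tmul_one (R : Type*) [CommRing R] [Algebra K R] (r : R) :
    adjoinRootTensorEquiv K n R (r ⊗ₜ 1) = AdjoinRoot.of _ r := by
  have h : AdjoinRoot.tensorAlgEquiv (T := R) (X ^ n : K[X]) (X ^ n) (by simp) (r ⊗ₜ 1) =
      AdjoinRoot.of _ (algebraMap R (R ⊗[K] K) r) :=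
    AlgEquiv.commutes _ r
  simp only [adjoinRootTensorEquiv, AlgEquiv.trans_apply, AlgEquiv.restrictScalars_apply, h]
  exact (AdjoinRoot.map_of _ (X ^ n : (R ⊗[K] K)[X]) _ (by simp) _).trans (by simp)

theorem adjoinRootTensorEquiv_one_tmul_root (R : Type*) [CommRing R] [Algebra K R] :
    adjoinRootTensorEquiv K n R (1 ⊗ₜ AdjoinRoot.root _) = AdjoinRoot.root _ := by
  simp only [adjoinRootTensorEquiv, AlgEquiv.trans_apply, AlgEquiv.restrictScalars_apply,
    AdjoinRoot.tensorAlgEquiv_root]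
  exact AdjoinRoot.map_root _ (X ^ n : (R ⊗[K] K)[X]) _ (by simp)

end TruncatedPolynomial

section PolynomialQuotient

variable {K R : Type*} [Field K] [CommRing R] [Algebra K R]

theorem finiteDimensional_quotient_span_of_monic [FiniteDimensional K R] {f : R[X]}
    (hf : f.Monic) : FiniteDimensional K (R[X] ⧸ Ideal.span {f}) :=
  have : Module.Finite R (R[X] ⧸ Ideal.span {f}) := hf.finite_quotient
  Module.Finite.trans R _

theorem finrank_quotient_span_of_monic [Nontrivial R] {f : R[X]} (hf : f.Monic) :
    Module.finrank K (R[X] ⧸ Ideal.span {f}) = Module.finrank K R * f.natDegree := by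
  have : Module.Free R (R[X] ⧸ Ideal.span {f}) := hf.free_quotient
  rw [← Module.finrank_mul_finrank K R, finrank_quotient_span_eq_natDegree' hf]

theorem exists_X_pow_eq_sub_pow_char_pow_mul (p : ℕ) [Fact p.Prime] [CharP R p] (α m : ℕ) {x : R}
    (hx : x ^ (p ^ α * m) = 0) :
    ∃ s : R[X], X ^ (p ^ α * m) = (X - C x) ^ p ^ α * s ∧
      s.eval x = m * x ^ (p ^ α * (m - 1)) := by
  refine ⟨∑ i ∈ Finset.range m, (X ^ p ^ α) ^ i * (C x ^ p ^ α) ^ (m - 1 - i), ?_, ?_⟩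
  · rw [sub_pow_char_pow, mul_comm (X ^ _ - _), geom_sum₂_mul, ← pow_mul, ← pow_mul, ← C_pow, hx,
      C_0, sub_zero]
  · simp only [eval_finsetSum, eval_mul, eval_pow, eval_X, eval_C, geom_sum₂_self, pow_mul]

theorem finrank_quotient_X_pow_sup_sub_pow_of_le [Nontrivial R] {p : ℕ} [Fact p.Prime]
    [CharP R p] {α m k : ℕ} {x : R} (hx : x ^ (p ^ α * m) = 0) (hk : k ≤ p ^ α) :
    Module.finrank K
        (R[X] ⧸ (Ideal.span {X ^ (p ^ α * m)} ⊔ Ideal.span {(X - C x) ^ k} : Ideal R[X])) =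
      Module.finrank K R * k := by
  obtain ⟨s, hs, -⟩ := exists_X_pow_eq_sub_pow_char_pow_mul p α m hx
  rw [sup_eq_right.2 (Ideal.span_singleton_le_span_singleton.2
    ((pow_dvd_pow _ hk).trans (hs ▸ dvd_mul_right _ _))),
    finrank_quotient_span_of_monic ((monic_X_sub_C x).pow k), (monic_X_sub_C x).natDegree_pow,
    natDegree_X_sub_C, mul_one]

theorem finrank_quotient_X_pow_sup_sub_pow_succ [Nontrivial R] [FiniteDimensional K R]
    {p : ℕ} [Fact p.Prime] [CharP R p] {α m : ℕ} {x : R} (hx : x ^ (p ^ α * m) = 0) (hm : IsUnit (m : R)) :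
    Module.finrank K
        (R[X] ⧸ (Ideal.span {X ^ (p ^ α * m)} ⊔ Ideal.span {(X - C x) ^ (p ^ α + 1)} :
          Ideal R[X])) =
      Module.finrank K R * p ^ α +
        Module.finrank K (R ⧸ Ideal.span {x ^ (p ^ α * (m - 1))}) := by
  obtain ⟨s, hs, hsx⟩ := exists_X_pow_eq_sub_pow_char_pow_mul p α m hx
  have hmonic := (monic_X_sub_C x).pow (p ^ α)
  have hI : Ideal.span {X ^ (p ^ α * m)} ⊔ Ideal.span {(X - C x) ^ (p ^ α + 1)} =
      Ideal.span {(X - C x) ^ p ^ α} * Ideal.span {C (s.eval x), X - C x} := by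
    have hspan : Ideal.span {C (s.eval x), X - C x} = Ideal.span {s} ⊔ Ideal.span {X - C x} := by
      obtain ⟨t, ht⟩ := X_sub_C_dvd_sub_C_eval (a := x) (p := s)
      have hst : s = C (s.eval x) + t * (X - C x) := by
        rw [mul_comm, ← ht, add_sub_cancel]
      have h := Ideal.span_pair_add_mul_right (x := C (s.eval x)) (y := X - C x) t
      rw [← hst] at h
      rw [← h, ← Ideal.span_union, Set.singleton_union]
    rw [hspan, Ideal.mul_sup, Ideal.span_singleton_mul_span_singleton,
      Ideal.span_singleton_mul_span_singleton, ← hs, pow_succ]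
  have : FiniteDimensional K (R[X] ⧸ Ideal.span {(X - C x) ^ p ^ α} *
      Ideal.span {C (s.eval x), X - C x}) := by
    rw [← hI]
    have := finiteDimensional_quotient_span_of_monic (K := K) (monic_X_pow (R := R) (p ^ α * m))
    exact Module.Finite.of_surjective
      (Ideal.Quotient.factorₐ K (le_sup_left : Ideal.span {(X ^ (p ^ α * m) : R[X])} ≤
        _ ⊔ Ideal.span {(X - C x) ^ (p ^ α + 1)})).toLinearMap
      (Ideal.Quotient.factor_surjective le_sup_left)
  rw [hI, finrank_quotient_span_singleton_mul hmonic.isRegular.left,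
    finrank_quotient_span_of_monic hmonic, (monic_X_sub_C x).natDegree_pow,
    natDegree_X_sub_C, mul_one,
    ((quotientSpanCXSubCAlgEquiv _ x).restrictScalars K).toLinearEquiv.finrank_eq, hsx,
    Ideal.span_singleton_mul_left_unit hm]

end PolynomialQuotient

section Tensor

variable {K V : Type*} [Field K] [AddCommGroup V] [Module K V] [FiniteDimensional K V]

theorem finrank_ker_lTensor_sub_rTensor_pow {n : ℕ} (hdim : Module.finrank K V = n)
    {M N : Module.End K V} (hM : M ^ n = 0) (hM' : M ^ (n - 1) ≠ 0) (hN : N ^ n = 0)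
    (hN' : N ^ (n - 1) ≠ 0) (m : ℕ) :
    Module.finrank K (LinearMap.ker ((N.lTensor V - M.rTensor V : Module.End K (V ⊗[K] V)) ^ m)) =
      Module.finrank K ((AdjoinRoot (X ^ n : K[X]))[X] ⧸
        (Ideal.span {X ^ n} ⊔ Ideal.span {(X - C (AdjoinRoot.root (X ^ n : K[X]))) ^ m} :
          Ideal (AdjoinRoot (X ^ n : K[X]))[X])) := by
  obtain ⟨φ, hφ⟩ := exists_linearEquiv_adjoinRoot_X_pow hdim hM hM'
  obtain ⟨ψ, hψ⟩ := exists_linearEquiv_adjoinRoot_X_pow hdim hN hN'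
  set R := AdjoinRoot (X ^ n : K[X])
  set x : R := AdjoinRoot.root (X ^ n : K[X])
  let E := adjoinRootTensorEquiv K n R
  let c : R ⊗[K] R := 1 ⊗ₜ x - x ⊗ₜ 1
  have hE : E c = AdjoinRoot.mk (X ^ n) (X - C x) := by
    rw [map_sub, adjoinRootTensorEquiv_one_tmul_root, adjoinRootTensorEquiv_tmul_one, map_sub,
      AdjoinRoot.mk_X, AdjoinRoot.mk_C]
  let Φ := TensorProduct.congr φ ψ
  have hΦ (z) : (N.lTensor V - M.rTensor V) (Φ z) = Φ (c * z) := by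
    induction z with
    | zero => simp
    | add a b ha hb => rw [map_add, map_add, ha, hb, mul_add, map_add]
    | tmul a b => simp [Φ, c, sub_mul, hφ, hψ]
  have hΦm (z) : ((N.lTensor V - M.rTensor V : Module.End K (V ⊗[K] V)) ^ m) (Φ z) =
      Φ (c ^ m * z) := by
    induction m with
    | zero => simp
    | succ m ih => rw [pow_succ', Module.End.mul_apply, ih, hΦ, pow_succ', mul_assoc]
  have : FiniteDimensional K (R ⊗[K] R) := Φ.symm.finiteDimensional
  have hker : LinearMap.ker ((N.lTensor V - M.rTensor V : Module.End K (V ⊗[K] V)) ^ m) =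
      (LinearMap.ker (LinearMap.mulLeft K (c ^ m))).map (Φ : R ⊗[K] R →ₗ[K] V ⊗[K] V) := by
    ext y
    obtain ⟨z, rfl⟩ := Φ.surjective y
    simp [hΦm]
  have h := finrank_quotient_sup_span (K := K) (Ideal.span {(X ^ n : R[X])}) ((X - C x) ^ m)
  rw [hker, LinearEquiv.finrank_map_eq, finrank_ker_mulLeft_eq_finrank_quotient, ← h]
  refine (Ideal.quotientEquivAlg (Ideal.span {c ^ m})
    (Ideal.span {AdjoinRoot.mk (X ^ n : R[X]) ((X - C x) ^ m)}) E ?_).toLinearEquiv.finrank_eq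
  rw [Ideal.map_span, Set.image_singleton, map_pow, ← hE]
  exact congr_arg (fun b ↦ Ideal.span {b}) (map_pow E c m).symm

theorem finrank_ker_map_sub_one_pow {n : ℕ} (hdim : Module.finrank K V = n)
    {u : Module.End K V} (hnil : (u - 1) ^ n = 0) (hblock : (u - 1) ^ (n - 1) ≠ 0) (m : ℕ) :
    Module.finrank K (LinearMap.ker ((TensorProduct.map u u - 1 : Module.End K (V ⊗[K] V)) ^ m)) =
      Module.finrank K ((AdjoinRoot (X ^ n : K[X]))[X] ⧸
        (Ideal.span {X ^ n} ⊔ Ideal.span {(X - C (AdjoinRoot.root (X ^ n : K[X]))) ^ m} :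
          Ideal (AdjoinRoot (X ^ n : K[X]))[X])) := by
  obtain ⟨v, rfl⟩ : IsUnit u := by
    simpa using IsNilpotent.isUnit_add_one ⟨n, hnil⟩
  set w : Module.End K V := ↑v⁻¹ with hw
  have hvw (a) : (v : Module.End K V) (w a) = a := LinearMap.congr_fun v.mul_inv a
  have hwv (a) : w ((v : Module.End K V) a) = a := LinearMap.congr_fun v.inv_mul a
  have hwu : w - 1 = w * -(v - 1) := by simp [hw, mul_sub]
  have hcomm : Commute w (-(v - 1)) := by
    simp [hw, Commute, SemiconjBy, mul_sub, sub_mul]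
  have hwpow (k : ℕ) : (w - 1) ^ k = 0 ↔ ((v : Module.End K V) - 1) ^ k = 0 := by
    rw [hwu, hcomm.mul_pow, (v⁻¹.isUnit.pow k).mul_right_eq_zero, neg_pow,
      ((isUnit_one.neg).pow k).mul_right_eq_zero]
  rw [← finrank_ker_lTensor_sub_rTensor_pow hdim ((hwpow n).2 hnil)
    (fun h ↦ hblock ((hwpow _).1 h)) hnil hblock]
  set T : Module.End K (V ⊗[K] V) :=
    ((v : Module.End K V) - 1).lTensor V - (w - 1).rTensor V with hT
  set S : Module.End K (V ⊗[K] V) := (v : Module.End K V).rTensor V with hS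
  have hfac : TensorProduct.map (v : Module.End K V) (v : Module.End K V) - 1 = S * T := by
    refine TensorProduct.ext' fun a b ↦ ?_
    simp [hS, hT, hvw]
  have hST : Commute S T := by
    refine TensorProduct.ext' fun a b ↦ ?_
    simp [hS, hT, hvw, hwv]
  have hSu : IsUnit S := v.isUnit.map (Module.End.rTensorAlgHom K V V)
  have hSinj : Function.Injective (S ^ m : Module.End K (V ⊗[K] V)) :=
    ((Module.End.isUnit_iff _).1 (hSu.pow m)).injective
  rw [hfac, hST.mul_pow, Module.End.mul_eq_comp, LinearMap.ker_comp_of_ker_eq_bot _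
    (LinearMap.ker_eq_bot.2 hSinj)]

end Tensor

theorem stmt4 {K V : Type*} [Field K] {p : ℕ} [Fact p.Prime] [CharP K p]
    [AddCommGroup V] [Module K V] [FiniteDimensional K V]
    (n : ℕ) (hn : 1 ≤ n) (hdim : Module.finrank K V = n)
    (u : V →ₗ[K] V) (hnil : (u - 1) ^ n = 0) (hblock : (u - 1) ^ (n - 1) ≠ 0) :
    (∀ m, 1 ≤ m → m < p ^ padicValNat p n →
      jordanBlocks (TensorProduct.map u u) m = 0) ∧
    jordanBlocks (TensorProduct.map u u) (p ^ padicValNat p n)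
      = p ^ padicValNat p n := by
  have hp : p.Prime := Fact.out
  obtain ⟨m', hm'⟩ := pow_padicValNat_dvd (p := p) (n := n)
  have hsuccdvd := pow_succ_padicValNat_not_dvd (p := p) (by omega : n ≠ 0)
  have hker := finrank_ker_map_sub_one_pow hdim hnil hblock
  generalize padicValNat p n = α at *
  have hndvd : ¬ p ∣ m' := fun h ↦ hsuccdvd <| by
    rw [hm', pow_succ]
    exact mul_dvd_mul_left _ h
  set R := AdjoinRoot (X ^ n : K[X])
  have hfin : Module.finrank K R = n :=
    finrank_quotient_span_eq_natDegree.trans (natDegree_X_pow n)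
  have : FiniteDimensional K R := Module.finite_of_finrank_pos (by omega)
  have : Nontrivial R := Module.nontrivial_of_finrank_pos (R := K) (by omega)
  have : CharP R p := charP_of_injective_algebraMap (algebraMap K R).injective p
  have hx : AdjoinRoot.root (X ^ n : K[X]) ^ (p ^ α * m') = 0 := by
    rw [← hm', ← AdjoinRoot.mk_X, ← map_pow, AdjoinRoot.mk_self]
  have hunit : IsUnit (m' : R) := by
    rw [← map_natCast (algebraMap K R)]
    refine (IsUnit.mk0 _ ?_).map _
    rwa [Ne, CharP.cast_eq_zero_iff K p]
  have hle (m : ℕ) (hm : m ≤ p ^ α) : Module.finrank K (LinearMap.ker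
      ((TensorProduct.map u u - 1 : Module.End K (V ⊗[K] V)) ^ m)) = n * m := by
    have h := finrank_quotient_X_pow_sup_sub_pow_of_le (K := K) hx hm
    rw [← hm', hfin] at h
    exact (hker m).trans h
  have hsucc : Module.finrank K (LinearMap.ker
      ((TensorProduct.map u u - 1 : Module.End K (V ⊗[K] V)) ^ (p ^ α + 1))) + p ^ α =
        n * p ^ α + n := by
    have h := finrank_quotient_X_pow_sup_sub_pow_succ (K := K) hx hunit
    have hm0 : 1 ≤ m' := Nat.pos_of_ne_zero (by rintro rfl; omega)
    have hsub : p ^ α * (m' - 1) + p ^ α = n := by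
      rw [← Nat.mul_succ, Nat.succ_eq_add_one, Nat.sub_add_cancel hm0, hm']
    rw [finrank_quotient_root_pow K n (by omega), ← hm', hfin] at h
    rw [hker, h]
    omega
  have hpos : 1 ≤ p ^ α := Nat.one_le_pow _ _ hp.pos
  constructor
  · intro m hm hmα
    rw [jordanBlocks, hle m hmα.le, hle (m + 1) hmα, hle (m - 1) (by omega)]
    push_cast [Nat.cast_sub hm]
    ring
  · rw [jordanBlocks, hle _ le_rfl, hle _ (Nat.sub_le _ _)]
    have := congr_arg (Nat.cast : ℕ → ℤ) hsucc
    push_cast [Nat.cast_sub hpos] at this ⊢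
    linarith
end

section
/- Let K be a field of characteristic p > 0, V a finite-dimensional K-vector space, and u a unipotent automorphism of V of Jordan type (d₁,…,d_t) with t ≥ 1 and all d_r ≥ 1. Let α = ν_p(gcd(d₁,…,d_t)), and let g = u ⊗ u acting on V ⊗ V. Then r_m(g) = 0 for all 1 ≤ m < p^α, and r_{p^α}(g) ≥ p^α. In other words, the smallest Jordan block size occurring in u ⊗ u on V ⊗ V is p^α, and it occurs with multiplicity at least p^α. -/
/-- `u` has Jordan type `(d 0, …, d (t-1))` on `V`: `V` is an internal direct sum of
`u`-invariant subspaces `W r` with `dim W r = d r` and `(u − 1)^(d r − 1) (W r) ≠ 0`. -/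
def IsJordanTypeOf {K V : Type*} [Field K] [AddCommGroup V] [Module K V]
    (u : V →ₗ[K] V) {t : ℕ} (d : Fin t → ℕ) : Prop :=
  ∃ W : Fin t → Submodule K V,
    DirectSum.IsInternal W ∧
    (∀ r, (W r).map u ≤ W r) ∧
    (∀ r, Module.finrank K (W r) = d r) ∧
    (∀ r, (W r).map ((u - 1) ^ (d r - 1)) ≠ ⊥)

open Polynomial in
theorem sub_one_pow_prime_pow {K A : Type*} [Field K] [Ring A] [Algebra K A] (p : ℕ)
    [Fact p.Prime] [CharP K p] (a : ℕ) (g : A) : (g - 1) ^ p ^ a = g ^ p ^ a - 1 := by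
  have h := congrArg (aeval g) (sub_pow_char_pow (p := p) (n := a) (X : K[X]) 1)
  simpa using h

open Polynomial in
theorem sub_one_pow_prime_pow_sub_one {K A : Type*} [Field K] [Ring A] [Algebra K A] (p : ℕ)
    [hp : Fact p.Prime] [CharP K p] (a : ℕ) (g : A) :
    (g - 1) ^ (p ^ a - 1) = ∑ i ∈ Finset.range (p ^ a), g ^ i := by
  have h1 : (X - 1 : K[X]) ^ (p ^ a - 1) = ∑ i ∈ Finset.range (p ^ a), X ^ i := by
    refine mul_right_cancel₀ (X_sub_C_ne_zero (1 : K)) ?_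
    rw [C_1, ← pow_succ, Nat.sub_add_cancel (Nat.pow_pos hp.out.pos), geom_sum_mul,
      sub_one_pow_prime_pow (K := K)]
  simpa using congrArg (aeval g) h1

theorem finrank_ker_pow_succ {K M : Type*} [Field K] [AddCommGroup M] [Module K M]
    [FiniteDimensional K M] (N : Module.End K M) (m : ℕ) :
    Module.finrank K (LinearMap.ker (N ^ (m + 1))) = Module.finrank K (LinearMap.ker (N ^ m)) +
      Module.finrank K (LinearMap.ker N ⊓ LinearMap.range (N ^ m) : Submodule K M) := by
  let f := (N ^ m).domRestrict (LinearMap.ker (N ^ (m + 1)))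
  have hr : LinearMap.range f = LinearMap.ker N ⊓ LinearMap.range (N ^ m) := by
    ext x
    constructor
    · rintro ⟨⟨y, hy⟩, rfl⟩
      refine ⟨?_, y, rfl⟩
      rw [LinearMap.mem_ker, pow_succ', Module.End.mul_apply] at hy
      exact hy
    · rintro ⟨hx, y, rfl⟩
      refine ⟨⟨y, ?_⟩, rfl⟩
      rw [LinearMap.mem_ker, pow_succ', Module.End.mul_apply]
      exact hx
  have hk : Module.finrank K (LinearMap.ker f) = Module.finrank K (LinearMap.ker (N ^ m)) := by
    rw [LinearMap.ker_domRestrict, (Submodule.comapSubtypeEquivOfLe _).finrank_eq]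
    intro x hx
    rw [LinearMap.mem_ker] at hx ⊢
    rw [pow_succ', Module.End.mul_apply, hx, map_zero]
  have h := f.finrank_range_add_finrank_ker
  rw [hr, hk] at h
  omega

theorem finrank_add_le_of_dual_family {K M : Type*} [Field K] [AddCommGroup M] [Module K M]
    [FiniteDimensional K M] {A B : Submodule K M} (hBA : B ≤ A) {n : ℕ} {c : K} (hc : c ≠ 0)
    (v : Fin n → M) (hv : ∀ i, v i ∈ A) (F : M →ₗ[K] (Fin n → K)) (hF : ∀ x ∈ B, F x = 0)
    (hFv : ∀ i, F (v i) = Pi.single i c) :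
    Module.finrank K B + n ≤ Module.finrank K A := by
  have hsurj : Function.Surjective (F.domRestrict A) := by
    intro y
    refine ⟨⟨∑ i, (y i / c) • v i, A.sum_mem fun i _ => A.smul_mem _ (hv i)⟩, ?_⟩
    rw [LinearMap.domRestrict_apply, map_sum]
    ext j
    simp [hFv, Pi.single_apply, hc]
  have h := (F.domRestrict A).finrank_range_add_finrank_ker
  rw [LinearMap.range_eq_top.2 hsurj, finrank_top, Module.finrank_fin_fun] at h
  have hB : B ≤ (LinearMap.ker (F.domRestrict A)).map A.subtype := by
    intro x hx
    exact ⟨⟨x, hBA hx⟩, by rw [SetLike.mem_coe, LinearMap.mem_ker]; exact hF x hx, rfl⟩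
  have h2 := Submodule.finrank_mono hB
  rw [Submodule.finrank_map_subtype_eq] at h2
  omega

theorem exists_projections_of_isInternal {K V : Type*} [Field K] [AddCommGroup V] [Module K V]
    (u : Module.End K V) {t : ℕ} (W : Fin t → Submodule K V) (hW : DirectSum.IsInternal W)
    (hu : ∀ r, ∀ x ∈ W r, u x ∈ W r) :
    ∃ π : ∀ r, V →ₗ[K] W r, (∀ r (x : W r), π r x = x) ∧
      (∀ x, ∑ r, (π r x : V) = x) ∧ ∀ r x, π r (u x) = u.restrict (hu r) (π r x) := by
  classical
  let _ := hW.chooseDecomposition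
  let π : ∀ r, V →ₗ[K] W r := fun r =>
    DirectSum.component K (Fin t) (fun i => W i) r ∘ₗ (DirectSum.decomposeLinearEquiv W).toLinearMap
  have hπ : ∀ r x, π r x = DirectSum.decompose W x r := fun r x => rfl
  have hsum : ∀ x, ∑ r, (π r x : V) = x := by
    intro x
    conv_rhs => rw [← (DirectSum.decompose W).symm_apply_apply x]
    rw [← DirectSum.sum_support_decompose W ((DirectSum.decompose W).symm _), Equiv.apply_symm_apply]
    symm
    refine Finset.sum_subset (Finset.subset_univ _) fun i _ hi => ?_
    simpa using hi
  refine ⟨π, fun r x => Subtype.ext (DirectSum.decompose_of_mem_same W x.2), hsum, fun r x => ?_⟩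
  conv_lhs => rw [← hsum x, map_sum, map_sum]
  rw [Finset.sum_eq_single r]
  · exact Subtype.ext (DirectSum.decompose_of_mem_same W (hu r _ (π r x).2))
  · intro s _ hs
    exact Subtype.ext (DirectSum.decompose_of_mem_ne W (hu s _ (π s x).2) hs)
  · simp

open Polynomial in
/-- A unipotent endomorphism with a single Jordan block of size `d` makes `W` the quotient of
`K[X]` by `(X - 1) ^ d`, with `X` acting as `u`. -/
theorem exists_surjective_of_single_block {K W : Type*} [Field K] [AddCommGroup W] [Module K W]
    [FiniteDimensional K W] (u : Module.End K W) (hu : IsNilpotent (u - 1)) {d : ℕ}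
    (hd : 1 ≤ d) (hW : Module.finrank K W = d) (hne : (u - 1) ^ (d - 1) ≠ 0) :
    ∃ ρ : K[X] →ₗ[K] W, (∀ p, ρ (X * p) = u (ρ p)) ∧ Function.Surjective ρ ∧
      ∀ p, ρ p = 0 ↔ (X - C 1) ^ d ∣ p := by
  have hpow : (u - 1) ^ d = 0 := by
    have h := LinearMap.aeval_self_charpoly (u - 1)
    rw [IsNilpotent.charpoly_eq_X_pow_finrank hu, hW] at h
    simpa using h
  obtain ⟨w, hw⟩ : ∃ w, ((u - 1) ^ (d - 1)) w ≠ 0 := by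
    by_contra! h
    exact hne (LinearMap.ext h)
  have hX : aeval u (X - C 1 : K[X]) = u - 1 := by simp
  let ρ : K[X] →ₗ[K] W := LinearMap.applyₗ w ∘ₗ (aeval u).toLinearMap
  have hρ : ∀ p, ρ p = aeval u p w := fun p => rfl
  have hker : ∀ p, ρ p = 0 ↔ (X - C 1) ^ d ∣ p := by
    intro p
    constructor
    · intro hp
      by_cases h0 : p = 0
      · simp [h0]
      obtain ⟨R, hR, hdvd⟩ := exists_eq_pow_rootMultiplicity_mul_and_not_dvd p h0 1
      set k := p.rootMultiplicity 1
      have hcop : IsCoprime ((X - C 1 : K[X]) ^ d) R :=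
        (((irreducible_X_sub_C (1 : K)).coprime_iff_not_dvd).2 hdvd).pow_left
      obtain ⟨a, b, hab⟩ := hcop
      have hk : ((u - 1) ^ k) w = 0 := by
        have h1 : (X - C 1 : K[X]) ^ k = (X - C 1) ^ k * a * (X - C 1) ^ d + b * p := by
          rw [hR]
          linear_combination -(X - C 1 : K[X]) ^ k * hab
        have h2 := congrArg (fun q => aeval u q w) h1
        simpa [map_mul, map_pow, hX, hpow, ← hρ, hp, -map_one, -map_sub] using h2
      have hdk : d ≤ k := by
        by_contra hlt
        apply hw
        rw [show d - 1 = (d - 1 - k) + k by omega, pow_add, Module.End.mul_apply, hk, map_zero]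
      rw [hR]
      exact (pow_dvd_pow _ hdk).mul_right _
    · rintro ⟨q, rfl⟩
      rw [hρ, map_mul, map_pow, hX, hpow, zero_mul, LinearMap.zero_apply]
  refine ⟨ρ, fun p => by simp [hρ], ?_, hker⟩
  have hinj : Function.Injective (ρ ∘ₗ (degreeLT K d).subtype) := by
    rw [← LinearMap.ker_eq_bot, LinearMap.ker_eq_bot']
    rintro ⟨p, hp⟩ h0
    have h1 := (hker p).1 h0
    rw [mem_degreeLT] at hp
    ext1
    refine eq_zero_of_dvd_of_degree_lt h1 ?_
    rwa [degree_pow, degree_X_sub_C, nsmul_one]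
  have hfin : Module.finrank K (degreeLT K d) = Module.finrank K W := by
    rw [(degreeLTEquiv K d).finrank_eq, hW, Module.finrank_fin_fun]
  have : FiniteDimensional K (degreeLT K d) := (degreeLTEquiv K d).symm.finiteDimensional
  have hs := (LinearMap.injective_iff_surjective_of_finrank_eq_finrank hfin).1 hinj
  exact fun x => let ⟨y, hy⟩ := hs x; ⟨y, hy⟩

open Polynomial in
theorem exists_equiv_of_single_block {K W W' : Type*} [Field K] [AddCommGroup W] [Module K W]
    [FiniteDimensional K W] [AddCommGroup W'] [Module K W'] [FiniteDimensional K W']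
    (u : Module.End K W) (hu : IsNilpotent (u - 1)) (u' : Module.End K W')
    (hu' : IsNilpotent (u' - 1)) {d : ℕ} (hd : 1 ≤ d)
    (hW : Module.finrank K W = d) (hne : (u - 1) ^ (d - 1) ≠ 0)
    (hW' : Module.finrank K W' = d) (hne' : (u' - 1) ^ (d - 1) ≠ 0) :
    ∃ θ : W ≃ₗ[K] W', ∀ x, θ (u x) = u' (θ x) := by
  obtain ⟨ρ, hX, hs, hk⟩ := exists_surjective_of_single_block u hu hd hW hne
  obtain ⟨ρ', hX', hs', hk'⟩ := exists_surjective_of_single_block u' hu' hd hW' hne'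
  have hker : LinearMap.ker ρ = LinearMap.ker ρ' := by
    ext p
    rw [LinearMap.mem_ker, LinearMap.mem_ker, hk, hk']
  let θ := (ρ.quotKerEquivOfSurjective hs).symm ≪≫ₗ Submodule.quotEquivOfEq _ _ hker ≪≫ₗ
    ρ'.quotKerEquivOfSurjective hs'
  have hθ : ∀ p, θ (ρ p) = ρ' p := by
    intro p
    have : (ρ.quotKerEquivOfSurjective hs).symm (ρ p) = Submodule.Quotient.mk p := by
      rw [LinearEquiv.symm_apply_eq]; rfl
    simp only [θ, LinearEquiv.trans_apply, this]
    rfl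
  refine ⟨θ, fun x => ?_⟩
  obtain ⟨p, rfl⟩ := hs x
  rw [← hX, hθ, hθ, hX']

/-- A single unipotent Jordan block is isomorphic to its contragredient. -/
theorem exists_equiv_dual_of_single_block {K W : Type*} [Field K] [AddCommGroup W] [Module K W]
    [FiniteDimensional K W] (u : Module.End K W) (hu : IsNilpotent (u - 1)) {d : ℕ}
    (hd : 1 ≤ d) (hW : Module.finrank K W = d) (hne : (u - 1) ^ (d - 1) ≠ 0)
    (v : Module.End K W) (huv : u * v = 1) :
    ∃ θ : W ≃ₗ[K] Module.Dual K W, ∀ x y, θ (u x) y = θ x (v y) := by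
  have hvu : v * u = 1 := mul_eq_one_comm.1 huv
  have hcomm : Commute (u - 1) v := by
    show (u - 1) * v = v * (u - 1)
    rw [sub_mul, mul_sub, huv, hvu, one_mul, mul_one]
  have hv1 : v - 1 = -((u - 1) * v) := by rw [sub_mul, huv, one_mul, neg_sub]
  have hpow : ∀ n : ℕ, (v - 1) ^ n = (-1) ^ n * ((u - 1) ^ n * v ^ n) := by
    intro n
    rw [hv1, neg_pow, hcomm.mul_pow]
  let T : Module.End K (Module.Dual K W) := Module.Dual.transpose (R := K) v
  have hT : ∀ (n : ℕ) (f : Module.Dual K W) (y : W), ((T - 1) ^ n) f y = f (((v - 1) ^ n) y) := by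
    intro n
    induction n with
    | zero => intro f y; rfl
    | succ n ih =>
      intro f y
      rw [pow_succ, Module.End.mul_apply, ih, pow_succ', Module.End.mul_apply]
      simp [T, Module.Dual.transpose_apply]
  have hTnil : IsNilpotent (T - 1) := by
    obtain ⟨n, hn⟩ := hu
    refine ⟨n, ?_⟩
    ext f y
    rw [hT, hpow, hn]
    simp
  have hTne : (T - 1) ^ (d - 1) ≠ 0 := by
    intro h0
    have h1 : (v - 1) ^ (d - 1) = 0 := by
      ext y
      rw [LinearMap.zero_apply, ← Module.forall_dual_apply_eq_zero_iff K]
      intro f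
      rw [← hT, h0]
      rfl
    apply hne
    have h2 : (u - 1) ^ (d - 1) = (-1) ^ (d - 1) * (v - 1) ^ (d - 1) * u ^ (d - 1) := by
      have h3 : v ^ (d - 1) * u ^ (d - 1) = 1 := by
        rw [← (show Commute v u from hvu.trans huv.symm).mul_pow, hvu, one_pow]
      rw [hpow, ← mul_assoc ((-1) ^ (d - 1)), ← (Commute.refl (-1)).mul_pow,
        neg_mul_neg, one_mul, one_pow, one_mul, mul_assoc, h3, mul_one]
    rw [h2, h1, mul_zero, zero_mul]
  obtain ⟨θ, hθ⟩ := exists_equiv_of_single_block u hu T hTnil hd hW hne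
    (by rw [Subspace.dual_finrank_eq, hW]) hTne
  refine ⟨θ, fun x y => ?_⟩
  rw [hθ]
  rfl

theorem sum_range_ite_dvd {R : Type*} [Semiring R] {q : ℕ} (hq : 0 < q) (n : ℕ) :
    ∑ i ∈ Finset.range (q * n), (if q ∣ i then 1 else 0 : R) = n := by
  induction n with
  | zero => simp
  | succ n ih =>
    rw [Nat.mul_succ, Finset.sum_range_add, ih, Finset.sum_eq_single 0]
    · simp
    · intro j hj hj0
      have : ¬ q ∣ j := Nat.not_dvd_of_pos_of_lt (Nat.pos_of_ne_zero hj0) (Finset.mem_range.1 hj)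
      rw [if_neg (by rwa [Nat.dvd_add_right (dvd_mul_right q n)])]
    · simp [hq]

open Polynomial in
/-- For a Jordan block of size `q * n`, with `q` a power of the characteristic, there is an
endomorphism that is diagonal in a cyclic basis `w, u w, u² w, …` and selects the exponents
divisible by `q`. -/
theorem exists_cyclic_selector {K W : Type*} [Field K] [AddCommGroup W] [Module K W]
    [FiniteDimensional K W] (p : ℕ) [Fact p.Prime] [CharP K p] (a : ℕ)
    (u : Module.End K W) (hu : IsNilpotent (u - 1)) {n : ℕ}
    (hd : 1 ≤ p ^ a * n) (hW : Module.finrank K W = p ^ a * n)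
    (hne : (u - 1) ^ (p ^ a * n - 1) ≠ 0) :
    ∃ (b : ℕ → W) (e : Module.End K W), (∀ k m, (u ^ k) (b m) = b (k + m)) ∧
      (∀ m, e (b m) = if p ^ a ∣ m then b m else 0) ∧
      Submodule.span K (Set.range b) = ⊤ ∧
      LinearIndependent K (fun i : Fin (p ^ a * n) => b i) := by
  obtain ⟨ρ, hX, hs, hk⟩ := exists_surjective_of_single_block u hu hd hW hne
  obtain ⟨s, hs'⟩ := ρ.exists_rightInverse_of_surjective (LinearMap.range_eq_top.2 hs)
  set q := p ^ a
  let B := basisMonomials K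
  have hB : ∀ m, B m = X ^ m := fun m => by simp [B, monomial_one_right_eq_X_pow]
  let c : K[X] →ₗ[K] K[X] := B.constr K fun m => if q ∣ m then X ^ m else 0
  have hc : ∀ m, c (X ^ m) = if q ∣ m then X ^ m else 0 := by
    intro m
    rw [← hB, B.constr_basis, hB]
  have hcq : ∀ f, c (X ^ q * f) = X ^ q * c f := by
    have : c ∘ₗ LinearMap.mulLeft K (X ^ q) = LinearMap.mulLeft K (X ^ q) ∘ₗ c := by
      refine B.ext fun m => ?_
      simp only [hB, LinearMap.comp_apply, LinearMap.mulLeft_apply, ← pow_add, hc,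
        Nat.dvd_add_right (dvd_refl q)]
      split_ifs <;> simp [pow_add]
    exact fun f => LinearMap.congr_fun this f
  have hcn : ∀ (m : ℕ) f, c ((X ^ q - 1) ^ m * f) = (X ^ q - 1) ^ m * c f := by
    intro m
    induction m with
    | zero => simp
    | succ m ih =>
      intro f
      rw [pow_succ, mul_assoc, ih, sub_mul, map_sub, hcq, one_mul]
      ring
  have hpow : (X - C 1 : K[X]) ^ (q * n) = (X ^ q - 1) ^ n := by
    rw [pow_mul, sub_pow_char_pow, C_1, one_pow]
  let e : Module.End K W := ρ ∘ₗ c ∘ₗ s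
  have he : ∀ f, e (ρ f) = ρ (c f) := by
    intro f
    have h1 : ρ (s (ρ f) - f) = 0 := by
      rw [map_sub, sub_eq_zero]
      exact LinearMap.congr_fun hs' (ρ f)
    rw [hk] at h1
    obtain ⟨g, hg⟩ := h1
    have h2 : ρ (c (s (ρ f) - f)) = 0 := by
      rw [hg, hpow, hcn, hk, hpow]
      exact dvd_mul_right _ _
    rwa [map_sub, map_sub, sub_eq_zero] at h2
  refine ⟨fun m => ρ (X ^ m), e, ?_, ?_, ?_, ?_⟩
  · intro k m
    induction k with
    | zero => simp
    | succ k ih =>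
      rw [pow_succ', Module.End.mul_apply, ih, ← hX, ← pow_succ']
      congr 2
      ring
  · intro m
    simp only [he, hc]
    split_ifs <;> simp
  · have h1 : Set.range (fun m => ρ (X ^ m)) = ρ '' Set.range B := by
      rw [← Set.range_comp]
      simp [Function.comp_def, hB]
    rw [h1, ← Submodule.map_span, B.span_eq, Submodule.map_top, LinearMap.range_eq_top.2 hs]
  · have h1 : LinearIndependent K (fun i : Fin (q * n) => B i) :=
      B.linearIndependent.comp _ Fin.val_injective
    have h2 : (fun i : Fin (q * n) => ρ (X ^ (i : ℕ))) = ρ ∘ fun i : Fin (q * n) => B i := by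
      ext i
      simp [hB]
    rw [h2]
    refine h1.map ?_
    rw [Submodule.disjoint_def]
    intro f hf hf0
    rw [LinearMap.mem_ker, hk] at hf0
    refine eq_zero_of_dvd_of_degree_lt hf0 ?_
    rw [degree_pow, degree_X_sub_C, nsmul_one, ← mem_degreeLT]
    refine (Submodule.span_le.2 ?_) hf
    rintro _ ⟨i, rfl⟩
    rw [SetLike.mem_coe, mem_degreeLT]
    simp only [hB, degree_X_pow]
    exact_mod_cast i.2

/-- A Jordan block of size divisible by `q = p ^ a` is relatively projective with respect to
`u ^ q`: there is a projection `e` commuting with `u ^ q` whose conjugates under the powers of `u` sum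
to `1`. The trace form detects the powers of `u`. -/
theorem exists_relative_projector {K W : Type*} [Field K] [AddCommGroup W] [Module K W]
    [FiniteDimensional K W] (p : ℕ) [hp : Fact p.Prime] [CharP K p] (a : ℕ)
    (u : Module.End K W) (hu : IsNilpotent (u - 1)) {n : ℕ}
    (hd : 1 ≤ p ^ a * n) (hW : Module.finrank K W = p ^ a * n)
    (hne : (u - 1) ^ (p ^ a * n - 1) ≠ 0) :
    ∃ e : Module.End K W, e * u ^ p ^ a = u ^ p ^ a * e ∧
      (∀ M, p ^ a ∣ M → p ^ a ≤ M → u ^ M = 1 →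
        ∑ i ∈ Finset.range (p ^ a), u ^ i * e * u ^ (M - i) = 1) ∧
      (∀ k, ¬ p ^ a ∣ k → LinearMap.trace K W (u ^ k * e) = 0) ∧
      LinearMap.trace K W e = n := by
  obtain ⟨b, e, hub, heb, hspan, hli⟩ := exists_cyclic_selector p a u hu hd hW hne
  set q := p ^ a
  have hq : 0 < q := Nat.pow_pos hp.out.pos
  have hext : ∀ {f g : Module.End K W}, (∀ m, f (b m) = g (b m)) → f = g := by
    intro f g h
    refine LinearMap.ext_on hspan ?_
    rintro _ ⟨m, rfl⟩
    exact h m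
  have hee : e * e = e := by
    refine hext fun m => ?_
    rw [Module.End.mul_apply, heb]
    split_ifs with h <;> simp [heb, h]
  refine ⟨e, ?_, ?_, ?_, ?_⟩
  · refine hext fun m => ?_
    simp only [Module.End.mul_apply, hub, heb, Nat.dvd_add_right (dvd_refl q)]
    split_ifs <;> simp [hub]
  · intro M hM hqM huM
    have hbM : ∀ m, b (M + m) = b m := fun m => by rw [← hub, huM, Module.End.one_apply]
    refine hext fun m => ?_
    have hterm : ∀ i ∈ Finset.range q,
        (u ^ i * e * u ^ (M - i)) (b m) = if i = m % q then b m else 0 := by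
      intro i hi
      rw [Finset.mem_range] at hi
      have hdvd : q ∣ M - i + m ↔ i = m % q := by
        rw [← Nat.modEq_zero_iff_dvd, ← Nat.ModEq.add_iff_left (Nat.ModEq.refl i),
          show i + (M - i + m) = M + m by omega, add_zero]
        unfold Nat.ModEq
        rw [Nat.add_mod, Nat.mod_eq_zero_of_dvd hM, zero_add, Nat.mod_mod, Nat.mod_eq_of_lt hi,
          eq_comm]
      rw [Module.End.mul_apply, Module.End.mul_apply, hub, heb]
      simp only [hdvd]
      split_ifs
      · rw [hub, show i + (M - i + m) = M + m by omega, hbM]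
      · simp
    rw [LinearMap.sum_apply, Finset.sum_congr rfl hterm, Finset.sum_ite_eq',
      if_pos (Finset.mem_range.2 (Nat.mod_lt _ hq)), Module.End.one_apply]
  · intro k hk
    have h0 : e * (u ^ k * e) = 0 := by
      refine hext fun m => ?_
      rw [Module.End.mul_apply, Module.End.mul_apply, heb]
      split_ifs with h
      · rw [hub, heb, if_neg, LinearMap.zero_apply]
        rwa [Nat.dvd_add_left h]
      · simp
    rw [← hee, ← mul_assoc, LinearMap.trace_mul_comm, h0, map_zero]
  · have : Nonempty (Fin (q * n)) := ⟨⟨0, hd⟩⟩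
    let B := basisOfLinearIndependentOfCardEqFinrank hli (by rw [Fintype.card_fin, hW])
    have hB : ∀ i, B i = b i := fun i => by simp [B]
    rw [LinearMap.trace_eq_matrix_trace K B, Matrix.trace, ← sum_range_ite_dvd hq,
      Finset.sum_range]
    refine Finset.sum_congr rfl fun i _ => ?_
    rw [Matrix.diag_apply, LinearMap.toMatrix_apply, hB, heb]
    split_ifs
    · rw [← hB, B.repr_self, Finsupp.single_eq_same]
    · simp

theorem exists_pow_eq_one_of_unipotent {K A : Type*} [Field K] [Ring A] [Algebra K A] (p : ℕ)
    [hp : Fact p.Prime] [CharP K p] (a : ℕ) (g : A) (hg : IsNilpotent (g - 1)) :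
    ∃ M, p ^ a ∣ M ∧ p ^ a ≤ M ∧ g ^ M = 1 := by
  obtain ⟨k, hk⟩ := hg
  refine ⟨p ^ (a + k), pow_dvd_pow _ (by omega), Nat.pow_le_pow_right hp.out.pos (by omega), ?_⟩
  rw [← sub_eq_zero, ← sub_one_pow_prime_pow (K := K)]
  refine pow_eq_zero_of_le ?_ hk
  exact (Nat.le_add_left k a).trans (Nat.lt_pow_self hp.out.one_lt).le

theorem ker_sub_one_le_range_of_sum_eq_one {K M : Type*} [Field K] [AddCommGroup M] [Module K M]
    (p : ℕ) [Fact p.Prime] [CharP K p] (a : ℕ) (g E : Module.End K M) (m : ℕ → ℕ)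
    (h : ∑ i ∈ Finset.range (p ^ a), g ^ i * E * g ^ m i = 1) :
    LinearMap.ker (g - 1) ≤ LinearMap.range ((g - 1) ^ (p ^ a - 1)) := by
  intro v hv
  have hgv : g v = v := by
    rw [LinearMap.mem_ker, LinearMap.sub_apply, Module.End.one_apply, sub_eq_zero] at hv
    exact hv
  have hpow : ∀ k, (g ^ k) v = v := by
    intro k
    induction k with
    | zero => rfl
    | succ k ih => rw [pow_succ, Module.End.mul_apply, hgv, ih]
  refine ⟨E v, ?_⟩
  rw [sub_one_pow_prime_pow_sub_one (K := K), LinearMap.sum_apply]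
  conv_rhs => rw [← Module.End.one_apply (R := K) v, ← h, LinearMap.sum_apply]
  simp only [Module.End.mul_apply, hpow]

/-- On the tensor square of a Jordan block of size `p ^ a * n` with `p ∤ n`, there are `p ^ a`
invariants dual to functionals that are invariant under the `p ^ a`-th power. -/
theorem exists_dual_invariants {K W : Type*} [Field K] [AddCommGroup W] [Module K W]
    [FiniteDimensional K W] (p : ℕ) [hp : Fact p.Prime] [CharP K p] (a : ℕ)
    (u : Module.End K W) (hu : IsNilpotent (u - 1)) {n : ℕ}
    (hd : 1 ≤ p ^ a * n) (hW : Module.finrank K W = p ^ a * n)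
    (hne : (u - 1) ^ (p ^ a * n - 1) ≠ 0) :
    ∃ (v : Fin (p ^ a) → TensorProduct K W W) (F : TensorProduct K W W →ₗ[K] (Fin (p ^ a) → K)),
      (∀ i, TensorProduct.map u u (v i) = v i) ∧
      (∀ x, F ((TensorProduct.map u u ^ p ^ a) x) = F x) ∧
      ∀ i, F (v i) = Pi.single i (n : K) := by
  obtain ⟨e, heu, -, htr, htr1⟩ := exists_relative_projector p a u hu hd hW hne
  obtain ⟨M, hM, hqM, huM⟩ := exists_pow_eq_one_of_unipotent (K := K) p a u hu
  set q := p ^ a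
  have hq : 0 < q := Nat.pow_pos hp.out.pos
  have huv : u * u ^ (M - 1) = 1 := by
    rw [← pow_succ', Nat.sub_add_cancel (hq.trans_le hqM), huM]
  obtain ⟨θ, hθ⟩ := exists_equiv_dual_of_single_block u hu hd hW hne _ huv
  set g : Module.End K (TensorProduct K W W) := TensorProduct.map u u
  let Ψ : TensorProduct K W W ≃ₗ[K] Module.End K W :=
    TensorProduct.congr θ (LinearEquiv.refl K W) ≪≫ₗ dualTensorHomEquiv K W W
  have hΨ : ∀ z, Ψ (g z) = u * Ψ z * u ^ (M - 1) := by
    intro z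
    induction z with
    | zero => simp
    | add x y hx hy => rw [map_add, map_add, hx, hy, map_add, mul_add, add_mul]
    | tmul x y =>
      ext z
      simp [g, Ψ, hθ]
  have hcomm : ∀ k l, u ^ k * u ^ l = u ^ l * u ^ k := fun k l => by
    rw [← pow_add, add_comm, pow_add]
  have hΨk : ∀ k z, Ψ ((g ^ k) z) = u ^ k * Ψ z * (u ^ (M - 1)) ^ k := by
    intro k z
    induction k with
    | zero => simp
    | succ k ih =>
      rw [pow_succ', Module.End.mul_apply, hΨ, ih, pow_succ' u, pow_succ (u ^ (M - 1))]
      simp only [mul_assoc]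
  let F : TensorProduct K W W →ₗ[K] (Fin q → K) := LinearMap.pi fun j =>
    LinearMap.trace K W ∘ₗ LinearMap.mulRight K (u ^ (M - j) * e) ∘ₗ Ψ.toLinearMap
  have hF : ∀ z j, F z j = LinearMap.trace K W (Ψ z * (u ^ (M - j) * e)) := fun z j => rfl
  refine ⟨fun i => Ψ.symm (u ^ (i : ℕ)), F, ?_, ?_, ?_⟩
  · intro i
    apply Ψ.injective
    rw [hΨ, Ψ.apply_symm_apply, ← pow_succ', pow_succ, mul_assoc, huv, mul_one]
  · intro z
    ext j
    rw [hF, hF, hΨk, mul_assoc, mul_assoc, LinearMap.trace_mul_comm]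
    congr 1
    have h1 : (u ^ (M - 1)) ^ q * u ^ q = 1 := by
      rw [← pow_mul, hcomm, pow_mul, ← (show Commute u (u ^ (M - 1)) from
        (Commute.refl u).pow_right _).mul_pow, huv, one_pow]
    rw [mul_assoc, mul_assoc, mul_assoc, heu, ← mul_assoc (u ^ (M - j)), hcomm, mul_assoc,
      ← mul_assoc _ (u ^ q), h1, one_mul]
  · intro i
    ext j
    rw [hF, Ψ.apply_symm_apply, ← mul_assoc, ← pow_add, Pi.single_apply]
    have hi := i.2
    have hj := j.2
    split_ifs with h
    · rw [h, show (i : ℕ) + (M - i) = M by omega, huM, one_mul, htr1]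
    · refine htr _ fun hdvd => h ?_
      obtain ⟨k, hk⟩ := hdvd
      obtain ⟨l, hl⟩ := hM
      have h1 : (i : ℤ) - j = q * (k - l) := by
        have : (i : ℤ) + M = q * k + j := by exact_mod_cast (by omega : (i : ℕ) + M = q * k + j)
        have h2 : (M : ℤ) = q * l := by exact_mod_cast hl
        linear_combination this - h2
      have h2 : (i : ℤ) - j = 0 := by
        refine Int.eq_zero_of_abs_lt_dvd (m := q) ⟨_, h1⟩ ?_
        rw [abs_lt]
        omega
      exact Fin.ext (by omega)

theorem stmt5 {K V : Type*} [Field K] {p : ℕ} [Fact p.Prime] [CharP K p]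
    [AddCommGroup V] [Module K V] [FiniteDimensional K V]
    (u : V ≃ₗ[K] V) (hu : IsNilpotent (u.toLinearMap - 1))
    {t : ℕ} (ht : 1 ≤ t) (d : Fin t → ℕ) (hd : ∀ r, 1 ≤ d r)
    (hJ : IsJordanTypeOf u.toLinearMap d) :
    (∀ m, 1 ≤ m → m < p ^ padicValNat p (Finset.univ.gcd d) →
      jordanBlocks (TensorProduct.map u.toLinearMap u.toLinearMap) m = 0) ∧
    p ^ padicValNat p (Finset.univ.gcd d) ≤
      jordanBlocks (TensorProduct.map u.toLinearMap u.toLinearMap)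
        (p ^ padicValNat p (Finset.univ.gcd d)) := by
  obtain ⟨W, hint, hWu, hWd, hWne⟩ := hJ
  have hp : p.Prime := Fact.out
  set u' : Module.End K V := u.toLinearMap
  set a := padicValNat p (Finset.univ.gcd d)
  set q := p ^ a
  have hq : 0 < q := Nat.pow_pos hp.pos
  have hmem : ∀ r, ∀ x ∈ W r, u' x ∈ W r := fun r x hx => hWu r ⟨x, hx, rfl⟩
  set w : ∀ r, Module.End K (W r) := fun r => u'.restrict (hmem r)
  have hw : ∀ r x, (w r x : V) = u' x := fun r x => rfl
  have hwpow : ∀ r (k : ℕ) x, ((w r ^ k) x : V) = (u' ^ k) x := by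
    intro r k
    induction k with
    | zero => intro x; rfl
    | succ k ih => intro x; rw [pow_succ, pow_succ, Module.End.mul_apply, ih, hw]; rfl
  have hwsub : ∀ r (k : ℕ) x, (((w r - 1) ^ k) x : V) = ((u' - 1) ^ k) x := by
    intro r k
    induction k with
    | zero => intro x; rfl
    | succ k ih => intro x; rw [pow_succ, pow_succ, Module.End.mul_apply, ih]; rfl
  have hwnil : ∀ r, IsNilpotent (w r - 1) := by
    intro r
    obtain ⟨k, hk⟩ := hu
    refine ⟨k, LinearMap.ext fun x => Subtype.ext ?_⟩
    rw [hwsub, hk]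
    rfl
  have hwne : ∀ r, (w r - 1) ^ (d r - 1) ≠ 0 := by
    intro r h0
    refine hWne r ((Submodule.eq_bot_iff _).2 ?_)
    rintro _ ⟨x, hx, rfl⟩
    rw [← hwsub r _ ⟨x, hx⟩, h0]
    rfl
  obtain ⟨π, hπ, hπsum, hπu⟩ := exists_projections_of_isInternal u' W hint hmem
  have hqd : ∀ r, ∃ n, d r = q * n := fun r =>
    pow_padicValNat_dvd.trans (Finset.gcd_dvd (Finset.mem_univ r))
  choose n hn using hqd
  set g : Module.End K (TensorProduct K V V) := TensorProduct.map u' u'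
  have hgpow : ∀ k, g ^ k = TensorProduct.map (u' ^ k) (u' ^ k) := fun k =>
    TensorProduct.map_pow u' u' k
  have hker : LinearMap.ker (g - 1) ≤ LinearMap.range ((g - 1) ^ (q - 1)) := by
    have hproj := fun r => exists_relative_projector p a (w r) (hwnil r) (n := n r)
      (by rw [← hn]; exact hd r) (by rw [← hn]; exact hWd r) (by rw [← hn]; exact hwne r)
    choose e _ hesum _ _ using hproj
    obtain ⟨M, hM, hqM, huM⟩ := exists_pow_eq_one_of_unipotent (K := K) p a u' hu
    have hwM : ∀ r, w r ^ M = 1 := fun r => LinearMap.ext fun x => Subtype.ext (by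
      rw [hwpow, huM]; rfl)
    let E : Module.End K V := ∑ r, (W r).subtype ∘ₗ e r ∘ₗ π r
    have hπpow : ∀ r (k : ℕ) x, π r ((u' ^ k) x) = (w r ^ k) (π r x) := by
      intro r k
      induction k with
      | zero => intro x; rfl
      | succ k ih => intro x; rw [pow_succ, pow_succ, Module.End.mul_apply, ih, hπu]; rfl
    have hE : ∑ i ∈ Finset.range q, u' ^ i * E * u' ^ (M - i) = 1 := by
      refine LinearMap.ext fun x => ?_
      have hterm : ∀ i, (u' ^ i * E * u' ^ (M - i)) x =
          ∑ r, (((w r ^ i * e r * w r ^ (M - i)) (π r x) : W r) : V) := by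
        intro i
        simp only [Module.End.mul_apply, E, LinearMap.sum_apply, LinearMap.comp_apply,
          Submodule.subtype_apply, map_sum, hπpow, hwpow]
      rw [LinearMap.sum_apply, Finset.sum_congr rfl fun i _ => hterm i, Finset.sum_comm,
        Module.End.one_apply]
      conv_rhs => rw [← hπsum x]
      refine Finset.sum_congr rfl fun r _ => ?_
      rw [← Submodule.coe_sum, ← LinearMap.sum_apply, hesum r M hM hqM (hwM r),
        Module.End.one_apply]
    refine ker_sub_one_le_range_of_sum_eq_one p a g (TensorProduct.map E 1) (fun i => M - i) ?_
    have hterm : ∀ i ∈ Finset.range (p ^ a), g ^ i * TensorProduct.map E 1 * g ^ (M - i) =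
        TensorProduct.map (u' ^ i * E * u' ^ (M - i)) 1 := by
      intro i hi
      rw [hgpow, hgpow, ← TensorProduct.map_mul, ← TensorProduct.map_mul, mul_one, ← pow_add,
        Nat.add_sub_of_le ((Finset.mem_range.1 hi).le.trans hqM), huM]
    rw [Finset.sum_congr rfl hterm]
    simp only [← TensorProduct.mapBilinear_apply]
    rw [← LinearMap.sum_apply, ← map_sum, hE, TensorProduct.mapBilinear_apply,
      TensorProduct.map_one]
  have hinf : ∀ m, m < q →
      Module.finrank K (LinearMap.ker (g - 1) ⊓ LinearMap.range ((g - 1) ^ m) :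
        Submodule K (TensorProduct K V V)) = Module.finrank K (LinearMap.ker (g - 1)) := by
    intro m hm
    rw [inf_eq_left.2]
    refine hker.trans ?_
    rw [show q - 1 = m + (q - 1 - m) by omega, pow_add]
    exact LinearMap.range_comp_le_range _ _
  have hjordan : ∀ m, 1 ≤ m → jordanBlocks g m =
      (Module.finrank K (LinearMap.ker (g - 1) ⊓ LinearMap.range ((g - 1) ^ (m - 1)) :
        Submodule K (TensorProduct K V V)) : ℤ) -
      Module.finrank K (LinearMap.ker (g - 1) ⊓ LinearMap.range ((g - 1) ^ m) :
        Submodule K (TensorProduct K V V)) := by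
    intro m hm
    have h1 := finrank_ker_pow_succ (g - 1) m
    have h2 := finrank_ker_pow_succ (g - 1) (m - 1)
    rw [Nat.sub_add_cancel hm] at h2
    unfold jordanBlocks
    rw [h1, h2]
    push_cast
    ring
  refine ⟨fun m hm hmq => ?_, ?_⟩
  · rw [hjordan m hm, hinf m hmq, hinf (m - 1) (by omega), sub_self]
  · rw [hjordan q hq, hinf (q - 1) (by omega)]
    have hgcd : Finset.univ.gcd d ≠ 0 := by
      intro h0
      have := Finset.gcd_eq_zero_iff.1 h0 ⟨0, ht⟩ (Finset.mem_univ _)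
      have := hd ⟨0, ht⟩
      omega
    obtain ⟨r, hr⟩ : ∃ r, ¬ p ∣ n r := by
      by_contra! h
      refine pow_succ_padicValNat_not_dvd (p := p) hgcd (Finset.dvd_gcd fun r _ => ?_)
      rw [hn r, pow_succ]
      exact Nat.mul_dvd_mul_left _ (h r)
    have hnr : (n r : K) ≠ 0 := by rwa [Ne, CharP.cast_eq_zero_iff K p]
    obtain ⟨v, F, hv, hF, hFv⟩ := exists_dual_invariants p a (w r) (hwnil r) (n := n r)
      (by rw [← hn]; exact hd r) (by rw [← hn]; exact hWd r) (by rw [← hn]; exact hwne r)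
    let ι : TensorProduct K (W r) (W r) →ₗ[K] TensorProduct K V V :=
      TensorProduct.map (W r).subtype (W r).subtype
    let P : TensorProduct K V V →ₗ[K] TensorProduct K (W r) (W r) :=
      TensorProduct.map (π r) (π r)
    have hιg : ∀ x, g (ι x) = ι (TensorProduct.map (w r) (w r) x) := by
      intro x
      rw [← LinearMap.comp_apply, ← LinearMap.comp_apply, ← TensorProduct.map_comp,
        ← TensorProduct.map_comp]
      rfl
    have hPg : ∀ x, P (g x) = TensorProduct.map (w r) (w r) (P x) := by
      intro x
      have h : π r ∘ₗ u' = w r ∘ₗ π r := LinearMap.ext fun x => hπu r x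
      rw [← LinearMap.comp_apply, ← LinearMap.comp_apply, ← TensorProduct.map_comp,
        ← TensorProduct.map_comp, h]
    have hPgk : ∀ (k : ℕ) x, P ((g ^ k) x) = (TensorProduct.map (w r) (w r) ^ k) (P x) := by
      intro k
      induction k with
      | zero => intro x; rfl
      | succ k ih =>
        intro x
        rw [pow_succ, pow_succ, Module.End.mul_apply, ih, hPg]
        rfl
    have hPι : ∀ x, P (ι x) = x := by
      intro x
      have h : π r ∘ₗ (W r).subtype = LinearMap.id := LinearMap.ext fun x => hπ r x
      rw [← LinearMap.comp_apply, ← TensorProduct.map_comp, h, TensorProduct.map_id,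
        LinearMap.id_apply]
    have hle := finrank_add_le_of_dual_family
      (A := LinearMap.ker (g - 1))
      (B := LinearMap.ker (g - 1) ⊓ LinearMap.range ((g - 1) ^ q)) inf_le_left hnr
      (fun i => ι (v i)) (fun i => by
        rw [LinearMap.mem_ker, LinearMap.sub_apply, Module.End.one_apply, hιg, hv, sub_self])
      (F ∘ₗ P) (by
        rintro _ ⟨-, y, rfl⟩
        rw [sub_one_pow_prime_pow (K := K), LinearMap.sub_apply, Module.End.one_apply, map_sub,
          LinearMap.comp_apply, LinearMap.comp_apply, hPgk, hF, sub_self])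
      (fun i => by rw [LinearMap.comp_apply, hPι, hFv])
    zify at hle
    linarith
end

section
/- Let K be a commutative ring, V₁ and V₂ K-modules, and u₁ ∈ End(V₁), u₂ ∈ End(V₂) linear endomorphisms. Set X₁ = u₁ − 1, X₂ = u₂ − 1, and let X = u₁ ⊗ u₂ − 1 on V₁ ⊗ V₂. Then for all v ∈ V₁, w ∈ V₂, and all k ≥ 1: X^k·(v ⊗ w) = ∑_{0 ≤ t ≤ k} ∑_{0 ≤ s ≤ t} C(k,t)·C(t,s) · (X₁^t v) ⊗ (X₂^{k−s} w), where C(a,b) denotes the binomial coefficient. -/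
open TensorProduct

theorem Commute.mul_one_add_add_pow {R : Type*} [Ring R] {a b : R} (h : Commute a b) (k : ℕ) :
    (a * (1 + b) + b) ^ k =
      ∑ t ∈ Finset.range (k + 1), ∑ s ∈ Finset.range (t + 1),
        (k.choose t * t.choose s) • (a ^ t * b ^ (k - s)) := by
  have hb : Commute (1 + b) b := (Commute.one_left b).add_left (Commute.refl b)
  have ha : Commute a (1 + b) := (Commute.one_right a).add_right h
  rw [(h.mul_left hb).add_pow]
  refine Finset.sum_congr rfl fun t ht => ?_
  rw [ha.mul_pow, (Commute.one_left b).add_pow, Finset.mul_sum, Finset.sum_mul, Finset.sum_mul]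
  refine Finset.sum_congr rfl fun s hs => ?_
  have hts : k - s = (t - s) + (k - t) := by
    simp only [Finset.mem_range] at ht hs
    omega
  rw [hts, pow_add, one_pow, one_mul, ← nsmul_eq_mul', ← nsmul_eq_mul', mul_smul_comm,
    smul_mul_assoc, smul_smul, mul_assoc]

theorem stmt7 {K : Type*} [CommRing K] {V₁ V₂ : Type*}
    [AddCommGroup V₁] [Module K V₁] [AddCommGroup V₂] [Module K V₂]
    (u₁ : V₁ →ₗ[K] V₁) (u₂ : V₂ →ₗ[K] V₂)
    (k : ℕ) (hk : 1 ≤ k) (v : V₁) (w : V₂) :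
    ((TensorProduct.map u₁ u₂ - 1) ^ k) (v ⊗ₜ[K] w) =
      ∑ t ∈ Finset.range (k + 1), ∑ s ∈ Finset.range (t + 1),
        (k.choose t * t.choose s) •
          (((u₁ - 1) ^ t) v ⊗ₜ[K] ((u₂ - 1) ^ (k - s)) w) := by
  have h : Commute (TensorProduct.map (u₁ - 1) (1 : V₂ →ₗ[K] V₂))
      (TensorProduct.map (1 : V₁ →ₗ[K] V₁) (u₂ - 1)) := by
    rw [Commute, SemiconjBy, ← TensorProduct.map_mul, ← TensorProduct.map_mul]
    simp only [one_mul, mul_one]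
  have hX : TensorProduct.map u₁ u₂ - 1 =
      TensorProduct.map (u₁ - 1) (1 : V₂ →ₗ[K] V₂) *
          (1 + TensorProduct.map (1 : V₁ →ₗ[K] V₁) (u₂ - 1)) +
        TensorProduct.map (1 : V₁ →ₗ[K] V₁) (u₂ - 1) := by
    ext x y
    simp [TensorProduct.sub_tmul, TensorProduct.tmul_sub]
  rw [hX, h.mul_one_add_add_pow]
  simp only [TensorProduct.map_pow, one_pow, ← TensorProduct.map_mul, one_mul, mul_one,
    LinearMap.sum_apply, LinearMap.smul_apply, TensorProduct.map_tmul]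
end

section
/- Let K be an algebraically closed field of characteristic p > 0 and V a K-vector space of dimension n ≥ 2 with p | n. Let u be a unipotent automorphism of V of Jordan type (d₁,…,d_t), and suppose ν_p(gcd(d₁,…,d_t)) = 0, i.e. p does not divide all of the d_r. Let u₀ be the conjugation action A ↦ u∘A∘u⁻¹ of u on End_K(V), and let u₀'' be the induced action of u on the quotient sl(V)/K·id_V of the trace-zero endomorphisms by the scalar matrices (note id_V ∈ sl(V) since p | n; this quotient realizes the irreducible SL(V)-module L(ϖ₁ + ϖ_{n−1})). Then r₁(u₀'') = r₁(u₀) − 2 and r_m(u₀'') = r_m(u₀) for all m ≠ 1. -/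
open Module LinearMap

section JordanBlocks

variable {K V W : Type*} [Field K] [AddCommGroup V] [Module K V] [AddCommGroup W] [Module K W]

theorem finrank_submodule_prod [FiniteDimensional K V] [FiniteDimensional K W]
    (p : Submodule K V) (q : Submodule K W) :
    finrank K (p.prod q) = finrank K p + finrank K q := by
  let e : (p.prod q) ≃ₗ[K] p × q :=
    { toFun := fun x => (⟨x.1.1, x.2.1⟩, ⟨x.1.2, x.2.2⟩)
      invFun := fun y => ⟨(y.1.1, y.2.1), y.1.2, y.2.2⟩
      map_add' := fun _ _ => rfl
      map_smul' := fun _ _ => rfl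
      left_inv := fun _ => rfl
      right_inv := fun _ => rfl }
  rw [e.finrank_eq, finrank_prod]

theorem jordanBlocks_prodMap [FiniteDimensional K V] [FiniteDimensional K W]
    (f : V →ₗ[K] V) (g : W →ₗ[K] W) (m : ℕ) :
    jordanBlocks (f.prodMap g) m = jordanBlocks f m + jordanBlocks g m := by
  have hker (k : ℕ) : finrank K (ker ((f.prodMap g - 1) ^ k)) =
      finrank K (ker ((f - 1) ^ k)) + finrank K (ker ((g - 1) ^ k)) := by
    have hpow : (f.prodMap g - 1) ^ k = ((f - 1) ^ k).prodMap ((g - 1) ^ k) :=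
      (map_pow (prodMapRingHom K V W) (f - 1, g - 1) k).symm
    rw [hpow, ker_prodMap, finrank_submodule_prod]
  simp only [jordanBlocks, hker, Nat.cast_add]
  ring

theorem jordanBlocks_conj (e : V ≃ₗ[K] W) (f : V →ₗ[K] V) (m : ℕ) :
    jordanBlocks (e.conj f) m = jordanBlocks f m := by
  have hker (k : ℕ) : finrank K (ker ((e.conj f - 1) ^ k)) = finrank K (ker ((f - 1) ^ k)) := by
    have hpow : (e.conj f - 1) ^ k = e.conj ((f - 1) ^ k) := by
      change (e.conjRingEquiv f - 1) ^ k = e.conjRingEquiv ((f - 1) ^ k)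
      rw [map_pow, map_sub, map_one]
    have hmap : ker (e.conj ((f - 1) ^ k)) = (ker ((f - 1) ^ k)).map e.toLinearMap := by
      ext x
      simp [LinearEquiv.conj_apply, Submodule.mem_map_equiv]
    rw [hpow, hmap]
    exact LinearEquiv.finrank_map_eq e _
  simp only [jordanBlocks, hker]

theorem finrank_ker_one_sub_one_pow {k : ℕ} (hk : k ≠ 0) :
    finrank K (ker ((1 - 1 : V →ₗ[K] V) ^ k)) = finrank K V := by
  rw [sub_self, zero_pow hk, ker_zero, finrank_top]

theorem jordanBlocks_one_one : jordanBlocks (1 : V →ₗ[K] V) 1 = finrank K V := by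
  have h0 : finrank K (ker ((1 - 1 : V →ₗ[K] V) ^ 0)) = 0 := by
    rw [pow_zero, Module.End.one_eq_id, ker_id, finrank_bot]
  rw [jordanBlocks, finrank_ker_one_sub_one_pow one_ne_zero,
    finrank_ker_one_sub_one_pow (Nat.succ_ne_zero 1), h0]
  ring

theorem jordanBlocks_one_of_two_le {m : ℕ} (hm : 2 ≤ m) :
    jordanBlocks (1 : V →ₗ[K] V) m = 0 := by
  rw [jordanBlocks, finrank_ker_one_sub_one_pow (by omega),
    finrank_ker_one_sub_one_pow (by omega), finrank_ker_one_sub_one_pow (by omega)]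
  ring

end JordanBlocks

section TraceZero

variable {K V : Type*} [Field K] [AddCommGroup V] [Module K V]

theorem exists_not_dvd_of_padicValNat_gcd_eq_zero {p t : ℕ} (hp : p ≠ 1) (ht : 1 ≤ t)
    (d : Fin t → ℕ) (hd : ∀ r, 1 ≤ d r) (h : padicValNat p (Finset.univ.gcd d) = 0) :
    ∃ r, ¬ p ∣ d r := by
  by_contra! hdvd
  rcases padicValNat.eq_zero_iff.1 h with h | h | h
  · exact hp h
  · have := Finset.gcd_eq_zero_iff.1 h ⟨0, ht⟩ (Finset.mem_univ _)
    have := hd ⟨0, ht⟩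
    omega
  · exact h (Finset.dvd_gcd fun r _ => hdvd r)

/-- The projection onto a summand of an invariant decomposition along the others commutes with
the endomorphism, and its trace is the dimension of the summand. -/
theorem exists_commute_trace_eq_finrank [FiniteDimensional K V] {ι : Type*} [DecidableEq ι]
    {W : ι → Submodule K V} (hW : DirectSum.IsInternal W) (f : V →ₗ[K] V)
    (hf : ∀ i, (W i).map f ≤ W i) (i : ι) :
    ∃ P : V →ₗ[K] V, Commute P f ∧ trace K V P = finrank K (W i) := by
  have hc : IsCompl (W i) (⨆ j ≠ i, W j) := by
    refine ⟨hW.submodule_iSupIndep i, codisjoint_iff.2 (eq_top_iff.2 ?_)⟩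
    rw [← hW.submodule_iSup_eq_top]
    refine iSup_le fun j => ?_
    by_cases hj : j = i
    · exact hj ▸ le_sup_left
    · exact le_sup_of_le_right (le_iSup₂_of_le j hj le_rfl)
  refine ⟨(W i).projection _ hc, ?_, ?_⟩
  · rw [(Submodule.isIdempotentElem_projection hc).commute_iff, Submodule.range_projection,
      Submodule.ker_projection]
    refine ⟨Submodule.map_le_iff_le_comap.1 (hf i), Submodule.map_le_iff_le_comap.1 ?_⟩
    simp only [Submodule.map_iSup]
    exact iSup₂_mono fun j _ => hf j
  · exact IsProj.trace ⟨fun x => Submodule.projection_apply_mem _ x,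
      fun x hx => Submodule.projection_apply_of_mem_left _ hx⟩

variable (K V) in
/-- The quotient of the trace-zero endomorphisms by the scalar ones. -/
abbrev TraceZeroModScalars : Type _ :=
  ↥(ker (trace K V)) ⧸ (Submodule.span K {(1 : V →ₗ[K] V)}).comap (ker (trace K V)).subtype

/-- For an endomorphism `P` of nonzero trace, the projection of an endomorphism to trace zero along
`P`. -/
noncomputable def traceZeroPart (P : V →ₗ[K] V) (hP : trace K V P ≠ 0) :
    (V →ₗ[K] V) →ₗ[K] ker (trace K V) :=
  (LinearMap.id - ((trace K V P)⁻¹ • trace K V).smulRight P).codRestrict _ fun A => by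
    simp [hP, mul_comm]

theorem coe_traceZeroPart (P : V →ₗ[K] V) (hP : trace K V P ≠ 0) (A : V →ₗ[K] V) :
    (traceZeroPart P hP A : V →ₗ[K] V) = A - ((trace K V P)⁻¹ * trace K V A) • P := rfl

/-- When the identity has trace zero, an endomorphism `P` of nonzero trace splits off the scalars
and the trace from `End V`. -/
noncomputable def endEquivTraceZeroModScalarsProd (h1 : trace K V 1 = 0) (P : V →ₗ[K] V)
    (hP : trace K V P ≠ 0) :
    (V →ₗ[K] V) ≃ₗ[K] TraceZeroModScalars K V × K × K :=
  LinearEquiv.ofBijective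
    ((Submodule.mkQ _ ∘ₗ traceZeroPart P hP).prod
      ((trace K V).prod (trace K V ∘ₗ LinearMap.mulLeft K P))) <| by
    constructor
    · rw [injective_iff_map_eq_zero]
      intro A hA
      have hA0 : trace K V A = 0 := congrArg (fun x => x.2.1) hA
      have hPA : trace K V (P * A) = 0 := congrArg (fun x => x.2.2) hA
      replace hA := (Submodule.Quotient.mk_eq_zero _).1 (congrArg Prod.fst hA)
      rw [Submodule.mem_comap, Submodule.subtype_apply, coe_traceZeroPart, hA0, mul_zero, zero_smul, sub_zero] at hA
      obtain ⟨c, rfl⟩ := Submodule.mem_span_singleton.1 hA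
      rw [mul_smul_comm, mul_one, map_smul, smul_eq_mul] at hPA
      rw [(mul_eq_zero.1 hPA).resolve_right hP, zero_smul]
    · rintro ⟨q, a, b⟩
      obtain ⟨B, rfl⟩ := Submodule.mkQ_surjective _ q
      have hB : trace K V (B : V →ₗ[K] V) = 0 := B.2
      set τ := trace K V P with hτ
      set c := τ⁻¹ * (b - trace K V (P * (B : V →ₗ[K] V)) - τ⁻¹ * a * trace K V (P * P)) with hc
      have htr : trace K V ((B : V →ₗ[K] V) + (τ⁻¹ * a) • P + c • 1) = a := by
        rw [map_add, map_add, map_smul, map_smul, hB, h1, ← hτ]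
        simp only [smul_eq_mul]
        field_simp
        ring
      refine ⟨(B : V →ₗ[K] V) + (τ⁻¹ * a) • P + c • 1, ?_⟩
      refine Prod.ext ?_ (Prod.ext htr ?_)
      · refine (Submodule.Quotient.eq _).2 ?_
        rw [Submodule.mem_comap, map_sub, Submodule.subtype_apply, Submodule.subtype_apply,
          coe_traceZeroPart, htr, ← hτ]
        exact Submodule.mem_span_singleton.2 ⟨c, by abel⟩
      · change trace K V (P * ((B : V →ₗ[K] V) + (τ⁻¹ * a) • P + c • 1)) = b
        rw [mul_add, mul_add, mul_smul_comm, mul_smul_comm, mul_one, map_add, map_add, map_smul,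
          map_smul, ← hτ, hc]
        simp only [smul_eq_mul]
        field_simp
        ring

theorem endEquivTraceZeroModScalarsProd_apply (h1 : trace K V 1 = 0) (P : V →ₗ[K] V)
    (hP : trace K V P ≠ 0) (A : V →ₗ[K] V) :
    endEquivTraceZeroModScalarsProd h1 P hP A =
      (Submodule.Quotient.mk (traceZeroPart P hP A), trace K V A, trace K V (P * A)) := rfl

end TraceZero

theorem stmt12 {K V : Type*} [Field K] [IsAlgClosed K] {p : ℕ} [Fact p.Prime] [CharP K p]
    [AddCommGroup V] [Module K V] [FiniteDimensional K V]
    (n : ℕ) (hn : 2 ≤ n) (hdim : Module.finrank K V = n) (hpn : p ∣ n)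
    (u : V ≃ₗ[K] V) (hu : IsNilpotent (u.toLinearMap - 1))
    {t : ℕ} (ht : 1 ≤ t) (d : Fin t → ℕ) (hd : ∀ r, 1 ≤ d r)
    (hJ : IsJordanTypeOf u.toLinearMap d)
    (hα : padicValNat p (Finset.univ.gcd d) = 0)
    -- `sl` is the subspace of trace-zero endomorphisms; `S` is the subspace of scalar
    -- multiples of the identity inside `sl` (as a pullback, since `p ∣ n` implies
    -- `id ∈ sl`); `u₁` is the restriction of the conjugation action `u.conj` to `sl`,
    -- and `u₀''` is the induced action on the quotient `sl ⧸ S ≅ L(ϖ₁ + ϖ_{n−1})`.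
    (u₁ : ↥(LinearMap.ker (LinearMap.trace K V)) →ₗ[K]
      ↥(LinearMap.ker (LinearMap.trace K V)))
    (hu₁ : ∀ A : ↥(LinearMap.ker (LinearMap.trace K V)),
      ((u₁ A : V →ₗ[K] V)) = u.conj (A : V →ₗ[K] V))
    (u₀'' : (↥(LinearMap.ker (LinearMap.trace K V)) ⧸
        (Submodule.span K {(1 : V →ₗ[K] V)}).comap
          (LinearMap.ker (LinearMap.trace K V)).subtype) →ₗ[K]
      (↥(LinearMap.ker (LinearMap.trace K V)) ⧸
        (Submodule.span K {(1 : V →ₗ[K] V)}).comap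
          (LinearMap.ker (LinearMap.trace K V)).subtype))
    (hu₀'' : ∀ A : ↥(LinearMap.ker (LinearMap.trace K V)),
      u₀'' (Submodule.Quotient.mk A) = Submodule.Quotient.mk (u₁ A)) :
    jordanBlocks u₀'' 1 = jordanBlocks u.conj.toLinearMap 1 - 2 ∧
    ∀ m, 1 ≤ m → m ≠ 1 → jordanBlocks u₀'' m = jordanBlocks u.conj.toLinearMap m := by
  obtain ⟨W, hW, hWu, hWd, -⟩ := hJ
  obtain ⟨r, hr⟩ := exists_not_dvd_of_padicValNat_gcd_eq_zero (Fact.out : p.Prime).ne_one ht d hd hα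
  obtain ⟨P, hPu, hPtr⟩ := exists_commute_trace_eq_finrank hW u.toLinearMap hWu r
  have hP : trace K V P ≠ 0 := by
    rwa [hPtr, hWd, Ne, CharP.cast_eq_zero_iff K p]
  have h1 : trace K V 1 = 0 := by
    rwa [trace_one, hdim, CharP.cast_eq_zero_iff K p]
  have hconjP : u.conj P = P := by
    ext x
    simpa [LinearEquiv.conj_apply] using (LinearMap.congr_fun hPu.eq (u.symm x)).symm
  have htrP (A : V →ₗ[K] V) : trace K V (P * u.conj A) = trace K V (P * A) := by
    rw [← trace_conj' (P * A) u]
    nth_rw 1 [← hconjP]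
    exact congrArg _ (map_mul u.conjRingEquiv P A).symm
  have hconj : (endEquivTraceZeroModScalarsProd h1 P hP).conj u.conj.toLinearMap =
      u₀''.prodMap 1 := by
    refine LinearMap.ext fun x => ?_
    obtain ⟨A, rfl⟩ := (endEquivTraceZeroModScalarsProd h1 P hP).surjective x
    have hpart : traceZeroPart P hP (u.conj A) = u₁ (traceZeroPart P hP A) := by
      refine Subtype.ext ?_
      rw [hu₁, coe_traceZeroPart, coe_traceZeroPart, map_sub, map_smul, hconjP, trace_conj']
    rw [LinearEquiv.conj_apply_apply, LinearEquiv.symm_apply_apply, LinearEquiv.coe_coe,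
      endEquivTraceZeroModScalarsProd_apply, endEquivTraceZeroModScalarsProd_apply,
      prodMap_apply, hu₀'', hpart, htrP, trace_conj']
    rfl
  have hblocks (m : ℕ) : jordanBlocks u.conj.toLinearMap m =
      jordanBlocks u₀'' m + jordanBlocks (1 : K × K →ₗ[K] K × K) m := by
    rw [← jordanBlocks_prodMap, ← hconj, jordanBlocks_conj]
  refine ⟨?_, fun m hm hm1 => ?_⟩
  · rw [hblocks, jordanBlocks_one_one, finrank_prod, finrank_self]
    norm_num
  · rw [hblocks, jordanBlocks_one_of_two_le (by omega), add_zero]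
end

section
/- Let K be an algebraically closed field of characteristic p > 0 and V a K-vector space of dimension n ≥ 2 with p | n. Let u be a unipotent automorphism of V of Jordan type (d₁,…,d_t), set α = ν_p(gcd(d₁,…,d_t)), and suppose α > 0. Let u₀ be the conjugation action A ↦ u∘A∘u⁻¹ of u on End_K(V), and let u₀'' be the induced action of u on sl(V)/K·id_V. Then: (a) if p | n/p^α, then r_{p^α}(u₀'') = r_{p^α}(u₀) − 2, r_{p^α−1}(u₀'') = 2, and r_m(u₀'') = r_m(u₀) for all m ∉ {p^α, p^α−1}; (b) if p ∤ n/p^α and p^α > 2, then r_{p^α}(u₀'') = r_{p^α}(u₀) − 1, r_{p^α−2}(u₀'') = 1, and r_m(u₀'') = r_m(u₀) for all m ∉ {p^α, p^α−2}; (c) if p ∤ n/p^α and p^α = 2, then r₂(u₀'') = r₂(u₀) − 1 and r_m(u₀'') = r_m(u₀) for all m ≠ 2. -/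
open Polynomial Module in
/-- The vectors killed by polynomials in a unipotent endomorphism acting on a cyclic vector. -/
theorem aeval_apply_eq_zero_iff_of_cyclic {K W : Type*} [Field K] [AddCommGroup W] [Module K W]
    {f : End K W} {d : ℕ} {v : W} (h0 : (f - 1) ^ d = 0)
    (hv : ((f - 1) ^ (d - 1)) v ≠ 0) (s : K[X]) :
    aeval f s v = 0 ↔ (X - C 1) ^ d ∣ s := by
  have hpow : ∀ k, aeval f ((X - C (1 : K)) ^ k) = (f - 1) ^ k := fun k ↦ by simp
  refine ⟨fun h ↦ ?_, ?_⟩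
  · by_contra hns
    have hs : s ≠ 0 := by rintro rfl; exact hns (dvd_zero _)
    obtain ⟨s', hs', hnd⟩ := exists_eq_pow_rootMultiplicity_mul_and_not_dvd s hs 1
    set j := rootMultiplicity 1 s
    have hj : j < d := by
      by_contra hj
      exact hns (hs' ▸ (pow_dvd_pow _ (not_lt.1 hj)).mul_right _)
    have hco : IsCoprime ((X - C (1 : K)) ^ d) s' :=
      ((irreducible_X_sub_C 1).coprime_iff_not_dvd.2 hnd).pow_left
    obtain ⟨a, b, hab⟩ := hco
    apply hv
    rw [← hpow]
    have : (X - C (1 : K)) ^ (d - 1) =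
        (a * (X - C 1) ^ (d - 1)) * (X - C 1) ^ d + (b * (X - C 1) ^ (d - 1 - j)) * s := by
      have e : (X - C (1 : K)) ^ (d - 1) = (X - C 1) ^ (d - 1 - j) * (X - C 1) ^ j := by
        rw [← pow_add]; congr 1; omega
      calc (X - C (1 : K)) ^ (d - 1) = (X - C (1 : K)) ^ (d - 1) * (a * (X - C 1) ^ d + b * s') := by
            rw [hab, mul_one]
        _ = (a * (X - C 1) ^ (d - 1)) * (X - C 1) ^ d
              + b * (X - C 1) ^ (d - 1 - j) * ((X - C 1) ^ j * s') := by rw [e]; ring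
        _ = _ := by rw [← hs']
    rw [this, map_add, map_mul, map_mul (aeval f) _ s, hpow d, h0]
    simp [h]
  · rintro ⟨c, rfl⟩
    rw [map_mul, hpow, h0]
    simp

open Polynomial in
/-- The projection of `K[X]` onto the polynomials in `X ^ q` killing the other monomials. -/
noncomputable def Polynomial.expandContract (K : Type*) [Field K] {q : ℕ} (hq : q ≠ 0) :
    K[X] →ₗ[K] K[X] where
  toFun s := expand K q (contract q s)
  map_add' a b := by rw [contract_add hq, map_add]
  map_smul' c a := by
    have : contract q (c • a) = c • contract q a := by
      ext n; simp [coeff_contract hq]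
    simp [this]

open Polynomial in
theorem Polynomial.expandContract_X_pow (K : Type*) [Field K] {q : ℕ} (hq : q ≠ 0) (k : ℕ) :
    expandContract K hq (X ^ k) = if q ∣ k then X ^ k else 0 := by
  ext m
  simp only [expandContract, LinearMap.coe_mk, AddHom.coe_mk,
    coeff_expand (Nat.pos_of_ne_zero hq), coeff_contract hq, coeff_X_pow]
  by_cases hm : q ∣ m
  · rw [if_pos hm, Nat.div_mul_cancel hm]
    by_cases hk : q ∣ k
    · rw [if_pos hk, coeff_X_pow]
    · rw [if_neg hk, coeff_zero, if_neg]
      rintro rfl; exact hk hm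
  · rw [if_neg hm]
    by_cases hk : q ∣ k
    · rw [if_pos hk, coeff_X_pow, if_neg]
      rintro rfl; exact hm hk
    · rw [if_neg hk, coeff_zero]

open Polynomial in
theorem Polynomial.expandContract_expand_mul (K : Type*) [Field K] {q : ℕ} (hq : q ≠ 0)
    (g s : K[X]) :
    expandContract K hq (expand K q g * s) = expand K q g * expandContract K hq s := by
  simp only [expandContract, LinearMap.coe_mk, AddHom.coe_mk]
  rw [mul_comm, contract_mul_expand hq, map_mul, mul_comm]

open Polynomial in
theorem Polynomial.sum_X_pow_mul_expandContract (K : Type*) [Field K] {q : ℕ} (hq : q ≠ 0)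
    (s : K[X]) :
    ∑ i ∈ Finset.range q, X ^ i * expandContract K hq (X ^ (q - 1 - i) * s)
      = X ^ (q - 1) * s := by
  induction s using Polynomial.induction_on' with
  | add a b ha hb => simp only [mul_add, map_add, Finset.sum_add_distrib, ha, hb]
  | monomial k c =>
    rw [← C_mul_X_pow_eq_monomial]
    have hq' : 0 < q := Nat.pos_of_ne_zero hq
    have key : ∀ i ∈ Finset.range q,
        X ^ i * expandContract K hq (X ^ (q - 1 - i) * (C c * X ^ k))
          = if i = (q - 1 + k) % q then X ^ (q - 1) * (C c * X ^ k) else 0 := by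
      intro i hi
      have hi := Finset.mem_range.1 hi
      have e : X ^ (q - 1 - i) * (C c * X ^ k) = c • (X ^ (q - 1 - i + k) : K[X]) := by
        rw [smul_eq_C_mul, pow_add]; ring
      have hiff : q ∣ q - 1 - i + k ↔ i = (q - 1 + k) % q := by
        have h1 : q - 1 - i + k = q - 1 + k - i := by omega
        rw [h1, ← Nat.modEq_iff_dvd' (by omega), Nat.ModEq, Nat.mod_eq_of_lt hi]
      rw [e, map_smul, expandContract_X_pow]
      by_cases h : q ∣ q - 1 - i + k
      · rw [if_pos h, if_pos (hiff.1 h), smul_eq_C_mul]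
        have : (X : K[X]) ^ (q - 1) = X ^ i * X ^ (q - 1 - i) := by
          rw [← pow_add]; congr 1; omega
        rw [this, pow_add]; ring
      · rw [if_neg h, if_neg (fun h' ↦ h (hiff.2 h'))]; simp
    rw [Finset.sum_congr rfl key, Finset.sum_ite_eq' , if_pos]
    exact Finset.mem_range.2 (Nat.mod_lt _ hq')

theorem Nat.card_filter_dvd_fin_mul {q : ℕ} (hq : 0 < q) (b : ℕ) :
    (Finset.univ.filter fun k : Fin (q * b) ↦ q ∣ (k : ℕ)).card = b := by
  have h := Finset.card_bij (s := Finset.univ (α := Fin b))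
    (t := Finset.univ.filter fun k : Fin (q * b) ↦ q ∣ (k : ℕ))
    (fun j _ ↦ ⟨q * j, Nat.mul_lt_mul_of_pos_left j.2 hq⟩)
    (fun j _ ↦ by simp)
    (fun i _ j _ hij ↦ by
      simpa [Fin.val_inj, hq.ne'] using hij)
    (fun k hk ↦ by
      obtain ⟨c, hc⟩ := (Finset.mem_filter.1 hk).2
      refine ⟨⟨c, Nat.lt_of_mul_lt_mul_left (a := q) (hc ▸ k.2)⟩, Finset.mem_univ _, ?_⟩
      exact Fin.ext hc.symm)
  rw [← h, Finset.card_univ, Fintype.card_fin]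

open Polynomial Module in
/-- A relative projectivity property of a unipotent Jordan block whose size is divisible by
`q = p ^ α`. -/
theorem exists_sum_conj_eq_of_jordanBlock {K W : Type*} [Field K] [AddCommGroup W] [Module K W]
    [FiniteDimensional K W] {p : ℕ} [Fact p.Prime] [CharP K p] {α b : ℕ} (f : End K W)
    (h0 : IsNilpotent (f - 1)) (hW : finrank K W = p ^ α * b)
    (h1 : (f - 1) ^ (p ^ α * b - 1) ≠ 0) :
    ∃ w : End K W,
      ∑ i ∈ Finset.range (p ^ α), f ^ i * w * f ^ (p ^ α - 1 - i) = f ^ (p ^ α - 1) ∧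
      LinearMap.trace K W w = b := by
  have hq : p ^ α ≠ 0 := pow_ne_zero _ (Fact.out : p.Prime).ne_zero
  set q := p ^ α with hqdef
  have h0' : (f - 1) ^ (q * b) = 0 := by
    have := (LinearMap.isNilpotent_iff_charpoly (f - 1)).1 h0
    have h2 := LinearMap.aeval_self_charpoly (f - 1)
    rw [this, hW] at h2
    simpa using h2
  obtain ⟨v, hv⟩ : ∃ v, ((f - 1) ^ (q * b - 1)) v ≠ 0 := by
    by_contra! h
    exact h1 (LinearMap.ext h)
  have hker := aeval_apply_eq_zero_iff_of_cyclic h0' hv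
  have hexp : (X - C (1 : K)) ^ (q * b) = expand K q ((X - C 1) ^ b) := by
    rw [map_pow, pow_mul, hqdef, sub_pow_char_pow]
    simp
  let Φ : K[X] →ₗ[K] W := (LinearMap.applyₗ v).comp (aeval f).toLinearMap
  have hΦ : ∀ s, Φ s = aeval f s v := fun s ↦ rfl
  have hΦmul : ∀ k s, Φ (X ^ k * s) = (f ^ k) (Φ s) := fun k s ↦ by
    simp [hΦ]
  have hli : LinearIndependent K (fun k : Fin (q * b) ↦ Φ (X ^ (k : ℕ))) := by
    rw [Fintype.linearIndependent_iff]
    intro c hc k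
    have h2 : Φ (∑ k : Fin (q * b), c k • X ^ (k : ℕ)) = 0 := by simpa using hc
    rw [hΦ, hker] at h2
    have hdeg : (∑ k : Fin (q * b), c k • (X : K[X]) ^ (k : ℕ)).degree
        < ((X - C (1 : K)) ^ (q * b)).degree := by
      rw [degree_pow, degree_X_sub_C, nsmul_one]
      refine (degree_sum_le _ _).trans_lt ((Finset.sup_lt_iff ?_).2 fun k _ ↦ ?_)
      · exact WithBot.bot_lt_coe _
      · exact (degree_smul_le _ _).trans_lt (by rw [degree_X_pow]; exact_mod_cast k.2)
    have h3 := congrArg (fun s ↦ coeff s (k : ℕ)) (eq_zero_of_dvd_of_degree_lt h2 hdeg)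
    simpa [finsetSum_coeff, coeff_X_pow, Fin.val_inj] using h3
  have : Nonempty (Fin (q * b)) := by
    by_contra h
    rw [not_nonempty_iff] at h
    have h2 : Fintype.card (Fin (q * b)) = 0 := Fintype.card_eq_zero_iff.2 h
    rw [Fintype.card_fin] at h2
    have : Subsingleton W := finrank_zero_iff.1 (hW.trans h2)
    exact hv (Subsingleton.elim _ _)
  let B := basisOfLinearIndependentOfCardEqFinrank hli (by rw [hW, Fintype.card_fin])
  have hB : ∀ k, B k = Φ (X ^ (k : ℕ)) := fun k ↦ by simp [B]
  have hsurj : Function.Surjective Φ := by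
    rw [← LinearMap.range_eq_top, eq_top_iff, ← B.span_eq, Submodule.span_le]
    rintro _ ⟨k, rfl⟩
    exact ⟨_, (hB k).symm⟩
  let T := expandContract K hq
  have hT : LinearMap.ker Φ ≤ LinearMap.ker (Φ ∘ₗ T) := by
    intro s hs
    rw [LinearMap.mem_ker, hΦ, hker, hexp] at hs
    obtain ⟨c, rfl⟩ := hs
    rw [LinearMap.mem_ker, LinearMap.comp_apply, expandContract_expand_mul, hΦ, hker, hexp]
    exact dvd_mul_right _ _
  let w : End K W := (LinearMap.ker Φ).liftQ (Φ ∘ₗ T) hT ∘ₗ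
    (Φ.quotKerEquivOfSurjective hsurj).symm.toLinearMap
  have hw : ∀ s, w (Φ s) = Φ (T s) := fun s ↦ by
    have : (Φ.quotKerEquivOfSurjective hsurj).symm (Φ s) = Submodule.Quotient.mk s := by
      rw [LinearEquiv.symm_apply_eq]; rfl
    simp [w, this]
  refine ⟨w, ?_, ?_⟩
  · ext x
    obtain ⟨s, rfl⟩ := hsurj x
    simp only [LinearMap.sum_apply, Module.End.mul_apply, ← hΦmul, hw]
    rw [← map_sum, sum_X_pow_mul_expandContract]
  · have hwB : ∀ k, w (B k) = if q ∣ (k : ℕ) then B k else 0 := fun k ↦ by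
      rw [hB, hw, expandContract_X_pow]
      split_ifs <;> simp
    rw [LinearMap.trace_eq_matrix_trace K B, Matrix.trace]
    simp only [Matrix.diag_apply, LinearMap.toMatrix_apply, hwB]
    have : ∀ k : Fin (q * b), (B.repr (if q ∣ (k : ℕ) then B k else 0)) k
        = if q ∣ (k : ℕ) then (1 : K) else 0 := fun k ↦ by
      split_ifs <;> simp
    simp only [this, Finset.sum_boole, Nat.card_filter_dvd_fin_mul (Nat.pos_of_ne_zero hq)]

theorem finrank_comap_eq {K A B : Type*} [Field K] [AddCommGroup A] [Module K A]
    [FiniteDimensional K A] [AddCommGroup B] [Module K B] (g : A →ₗ[K] B) (P : Submodule K B) :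
    Module.finrank K (P.comap g) =
      Module.finrank K (LinearMap.range g ⊓ P : Submodule K B) +
        Module.finrank K (LinearMap.ker g) := by
  have h := (g.domRestrict (P.comap g)).finrank_range_add_finrank_ker
  rw [LinearMap.range_domRestrict, Submodule.map_comap_eq, LinearMap.ker_domRestrict] at h
  rw [← h, (Submodule.comapSubtypeEquivOfLe
    (show LinearMap.ker g ≤ P.comap g from Submodule.comap_mono bot_le)).finrank_eq]

/-- The kernel of a power of the endomorphism induced on the subquotient `ker f / ⟨e⟩`. -/
theorem finrank_ker_pow_subquotient {K W : Type*} [Field K] [AddCommGroup W] [Module K W]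
    [FiniteDimensional K W] {N : Module.End K W} {f : W →ₗ[K] K} {e : W} (he : e ≠ 0)
    (hfe : f e = 0) {N₁ : Module.End K (LinearMap.ker f)} (hN₁ : ∀ A, (N₁ A : W) = N A)
    {S : Submodule K (LinearMap.ker f)}
    (hS : S = (Submodule.span K {e}).comap (LinearMap.ker f).subtype)
    {N₂ : Module.End K (LinearMap.ker f ⧸ S)}
    (hN₂ : ∀ A, N₂ (Submodule.Quotient.mk A) = Submodule.Quotient.mk (N₁ A)) (m : ℕ) :
    Module.finrank K (LinearMap.ker (N₂ ^ m)) + 1 =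
      Module.finrank K
        (LinearMap.ker f ⊓ (Submodule.span K {e}).comap (N ^ m) : Submodule K W) := by
  have h₁ : ∀ m A, ((N₁ ^ m) A : W) = (N ^ m) A := fun m ↦ by
    induction m with
    | zero => simp
    | succ m ih => intro A; rw [pow_succ, pow_succ, Module.End.mul_apply, ih, hN₁]; rfl
  have h₂ : ∀ m A, (N₂ ^ m) (S.mkQ A) = S.mkQ ((N₁ ^ m) A) := fun m ↦ by
    induction m with
    | zero => simp
    | succ m ih =>
      intro A
      have := hN₂ A
      rw [pow_succ, pow_succ, Module.End.mul_apply, Submodule.mkQ_apply, this]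
      exact ih _
  have hle : Submodule.span K {e} ≤ LinearMap.ker f := by
    rw [Submodule.span_singleton_le_iff_mem]; exact hfe
  have hker : Module.finrank K (LinearMap.ker S.mkQ) = 1 := by
    rw [Submodule.ker_mkQ, hS, (Submodule.comapSubtypeEquivOfLe hle).finrank_eq,
      finrank_span_singleton he]
  have hcomap := finrank_comap_eq S.mkQ (LinearMap.ker (N₂ ^ m))
  rw [Submodule.range_mkQ, top_inf_eq, hker] at hcomap
  rw [← hcomap]
  have hmap : ((LinearMap.ker (N₂ ^ m)).comap S.mkQ).map (LinearMap.ker f).subtype =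
      LinearMap.ker f ⊓ (Submodule.span K {e}).comap (N ^ m) := by
    have : (LinearMap.ker (N₂ ^ m)).comap S.mkQ =
        ((Submodule.span K {e}).comap (N ^ m)).comap (LinearMap.ker f).subtype := by
      ext A
      rw [Submodule.mem_comap, LinearMap.mem_ker, h₂, Submodule.mkQ_apply,
        Submodule.Quotient.mk_eq_zero, hS, Submodule.mem_comap, Submodule.mem_comap,
        Submodule.mem_comap, Submodule.subtype_apply, h₁, Submodule.subtype_apply]
    rw [this, Submodule.map_comap_subtype]
  rw [← hmap, Submodule.finrank_map_subtype_eq]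

theorem finrank_ker_inf_add_one {K W : Type*} [Field K] [AddCommGroup W] [Module K W]
    [FiniteDimensional K W] (f : W →ₗ[K] K) {P : Submodule K W} {a : W} (ha : a ∈ P)
    (hfa : f a ≠ 0) :
    Module.finrank K (LinearMap.ker f ⊓ P : Submodule K W) + 1 = Module.finrank K P := by
  have h := (f.domRestrict P).finrank_range_add_finrank_ker
  have hr : LinearMap.range (f.domRestrict P) = ⊤ := by
    refine LinearMap.range_eq_top.2 (LinearMap.surjective fun h0 ↦ hfa ?_)
    exact LinearMap.congr_fun h0 ⟨a, ha⟩
  rw [hr, finrank_top, Module.finrank_self, LinearMap.ker_domRestrict] at h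
  rw [← h, add_comm, ← Submodule.finrank_map_subtype_eq, inf_comm,
    ← Submodule.map_comap_subtype]

section Subquotient

variable {K W : Type*} [Field K] [AddCommGroup W] [Module K W] [FiniteDimensional K W]
  {N : Module.End K W} {q : ℕ}

theorem finrank_ker_pow_succ_s13 (hker : LinearMap.ker N ≤ LinearMap.range (N ^ (q - 1))) {m : ℕ}
    (hm : m < q) :
    Module.finrank K (LinearMap.ker (N ^ (m + 1))) =
      Module.finrank K (LinearMap.ker (N ^ m)) + Module.finrank K (LinearMap.ker N) := by
  have h : LinearMap.ker (N ^ (m + 1)) = (LinearMap.ker N).comap (N ^ m) := by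
    ext x; simp [pow_succ', Module.End.mul_apply]
  have hr : LinearMap.ker N ≤ LinearMap.range (N ^ m) := by
    refine hker.trans ?_
    rintro _ ⟨x, rfl⟩
    refine ⟨(N ^ (q - 1 - m)) x, ?_⟩
    rw [← Module.End.mul_apply, ← pow_add]
    congr 2; omega
  rw [h, finrank_comap_eq, inf_eq_right.2 hr, add_comm]

omit [FiniteDimensional K W] in
theorem apply_eq_zero_of_pow_apply_eq_zero
    (hker : LinearMap.ker N ≤ LinearMap.range (N ^ (q - 1))) {f : W →ₗ[K] K}
    (hf : ∀ x, f (N x) = 0) {m : ℕ} (hm : m < q) {x : W} (hx : (N ^ m) x = 0) : f x = 0 := by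
  induction m generalizing x with
  | zero => simp_all
  | succ m ih =>
    rw [pow_succ', Module.End.mul_apply] at hx
    obtain ⟨z, hz⟩ := hker hx
    have e : N ^ (q - 1) = N ^ m * N ^ (q - 1 - m) := by rw [← pow_add]; congr 1; omega
    rw [e, Module.End.mul_apply] at hz
    have h := ih (by omega) (x := x - (N ^ (q - 1 - m)) z) (by rw [map_sub, hz, sub_self])
    have e' : N ^ (q - 1 - m) = N * N ^ (q - 2 - m) := by rw [← pow_succ']; congr 1; omega
    rw [map_sub, e', Module.End.mul_apply, hf, sub_zero] at h
    exact h

variable {f : W →ₗ[K] K} {e w : W}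
  {N₁ : Module.End K (LinearMap.ker f)}
  {N₂ : Module.End K (LinearMap.ker f ⧸ (Submodule.span K {e}).comap (LinearMap.ker f).subtype)}

theorem finrank_comap_span_of_lt (he : e ≠ 0) (hw : (N ^ (q - 1)) w = e) {m : ℕ} (hm : m < q) :
    Module.finrank K ((Submodule.span K {e}).comap (N ^ m)) =
      Module.finrank K (LinearMap.ker (N ^ m)) + 1 := by
  rw [finrank_comap_eq, inf_eq_right.2, finrank_span_singleton he, add_comm]
  rw [Submodule.span_singleton_le_iff_mem]
  refine ⟨(N ^ (q - 1 - m)) w, ?_⟩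
  rw [← hw, ← Module.End.mul_apply, ← pow_add]
  congr 2; omega

theorem finrank_ker_subquotient_of_lt (he : e ≠ 0) (hfe : f e = 0)
    (hf : ∀ x, f (N x) = 0) (hker : LinearMap.ker N ≤ LinearMap.range (N ^ (q - 1)))
    (hw : (N ^ (q - 1)) w = e)
    (hN₁ : ∀ A, (N₁ A : W) = N A)
    (hN₂ : ∀ A, N₂ (Submodule.Quotient.mk A) = Submodule.Quotient.mk (N₁ A)) {m : ℕ} (hm : m < q)
    (hfw : m + 1 < q ∨ f w = 0) :
    Module.finrank K (LinearMap.ker (N₂ ^ m)) = Module.finrank K (LinearMap.ker (N ^ m)) := by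
  have h := finrank_ker_pow_subquotient he hfe hN₁ rfl hN₂ m
  rw [inf_eq_right.2, finrank_comap_span_of_lt he hw hm] at h
  · omega
  · intro x hx
    obtain ⟨c, hc⟩ := Submodule.mem_span_singleton.1 (Submodule.mem_comap.1 hx)
    have e1 : N ^ (q - 1) = N ^ m * N ^ (q - 1 - m) := by rw [← pow_add]; congr 1; omega
    have hz : (N ^ m) (x - c • (N ^ (q - 1 - m)) w) = 0 := by
      rw [map_sub, map_smul, ← Module.End.mul_apply, ← e1, hw, hc, sub_self]
    have h0 := apply_eq_zero_of_pow_apply_eq_zero hker hf hm hz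
    have h1 : f ((N ^ (q - 1 - m)) w) = 0 := by
      by_cases hm' : m + 1 < q
      · have e2 : N ^ (q - 1 - m) = N * N ^ (q - 2 - m) := by rw [← pow_succ']; congr 1; omega
        rw [e2, Module.End.mul_apply, hf]
      · have : q - 1 - m = 0 := by omega
        rw [this, pow_zero, Module.End.one_apply]
        exact hfw.resolve_left hm'
    rw [map_sub, map_smul, h1, smul_zero, sub_zero] at h0
    exact h0

theorem finrank_ker_subquotient_of_add_one_eq (he : e ≠ 0) (hfe : f e = 0)
    (hw : (N ^ (q - 1)) w = e)
    (hN₁ : ∀ A, (N₁ A : W) = N A)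
    (hN₂ : ∀ A, N₂ (Submodule.Quotient.mk A) = Submodule.Quotient.mk (N₁ A)) {m : ℕ}
    (hm : m + 1 = q) (hfw : f w ≠ 0) :
    Module.finrank K (LinearMap.ker (N₂ ^ m)) + 1 = Module.finrank K (LinearMap.ker (N ^ m)) := by
  have h := finrank_ker_pow_subquotient he hfe hN₁ rfl hN₂ m
  have hm' : m = q - 1 := by omega
  have h1 := finrank_ker_inf_add_one f (P := (Submodule.span K {e}).comap (N ^ m)) (a := w)
    (by rw [Submodule.mem_comap, hm', hw]; exact Submodule.mem_span_singleton_self e) hfw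
  rw [finrank_comap_span_of_lt he hw (by omega)] at h1
  omega

theorem finrank_ker_subquotient_of_le (he : e ≠ 0) (hfe : f e = 0)
    {a : W} (ha : (N ^ q) a = 0) (hfa : f a ≠ 0) (heN : e ∉ LinearMap.range (N ^ q))
    (hN₁ : ∀ A, (N₁ A : W) = N A)
    (hN₂ : ∀ A, N₂ (Submodule.Quotient.mk A) = Submodule.Quotient.mk (N₁ A)) {m : ℕ}
    (hm : q ≤ m) :
    Module.finrank K (LinearMap.ker (N₂ ^ m)) + 2 = Module.finrank K (LinearMap.ker (N ^ m)) := by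
  have h := finrank_ker_pow_subquotient he hfe hN₁ rfl hN₂ m
  have hp : N ^ m = N ^ q * N ^ (m - q) := by rw [← pow_add]; congr 1; omega
  have hp' : N ^ m = N ^ (m - q) * N ^ q := by rw [← pow_add]; congr 1; omega
  have h1 := finrank_ker_inf_add_one f (P := (Submodule.span K {e}).comap (N ^ m)) (a := a)
    (by rw [Submodule.mem_comap, hp', Module.End.mul_apply, ha, map_zero]; exact zero_mem _) hfa
  have hbot : LinearMap.range (N ^ m) ⊓ Submodule.span K {e} = ⊥ := by
    rw [eq_bot_iff]
    rintro x ⟨⟨y, hy⟩, hx⟩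
    obtain ⟨c, rfl⟩ := Submodule.mem_span_singleton.1 hx
    by_cases hc : c = 0
    · simp [hc]
    · refine absurd ⟨c⁻¹ • (N ^ (m - q)) y, ?_⟩ heN
      rw [map_smul, ← Module.End.mul_apply, ← hp, hy, inv_smul_smul₀ hc]
  rw [finrank_comap_eq, hbot, finrank_bot] at h1
  omega

end Subquotient

open Module in
/-- If all block sizes of `u` are divisible by `q = p ^ α`, the projections `π r` onto the blocks
are relative traces from `⟨u ^ q⟩` to `⟨u⟩` of endomorphisms `P r` of trace `d r / q`. -/
theorem exists_sum_conj_eq_of_isJordanTypeOf {K V : Type*} [Field K] [AddCommGroup V] [Module K V]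
    [FiniteDimensional K V] {p : ℕ} [Fact p.Prime] [CharP K p] {u : End K V}
    (hu : IsNilpotent (u - 1)) {t : ℕ} {d : Fin t → ℕ} (hJ : IsJordanTypeOf u d) {α : ℕ}
    {b : Fin t → ℕ} (hb : ∀ r, d r = p ^ α * b r) :
    ∃ P π : Fin t → End K V,
      (∀ r, ∑ i ∈ Finset.range (p ^ α), u ^ i * P r * u ^ (p ^ α - 1 - i)
        = u ^ (p ^ α - 1) * π r) ∧
      (∀ r, u * π r = π r * u) ∧ ∑ r, π r = 1 ∧ (∀ r, LinearMap.trace K V (P r) = b r) ∧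
      finrank K V = ∑ r, d r := by
  obtain ⟨W, hW, hinv, hdim, hne⟩ := hJ
  set q := p ^ α
  have hinv' : ∀ r, ∀ x ∈ W r, u x ∈ W r := fun r x hx ↦ hinv r ⟨x, hx, rfl⟩
  obtain ⟨g, hg⟩ : ∃ g : ∀ r, End K (W r), ∀ r (x : W r), (g r x : V) = u x :=
    ⟨fun r ↦ u.restrict (hinv' r), fun _ _ ↦ rfl⟩
  have hpow : ∀ r k (x : W r), ((g r ^ k) x : V) = (u ^ k) x := by
    intro r k
    induction k with
    | zero => simp
    | succ k ih => intro x; rw [pow_succ, pow_succ, End.mul_apply, ih, hg, End.mul_apply]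
  have hpow1 : ∀ r k (x : W r), (((g r - 1 : End K (W r)) ^ k) x : V) = ((u - 1 : End K V) ^ k) x := by
    intro r k
    induction k with
    | zero => simp
    | succ k ih =>
      intro x
      rw [pow_succ, pow_succ, End.mul_apply, ih, End.mul_apply]
      simp [hg]
  have hblock : ∀ r, ∃ w : End K (W r),
      ∑ i ∈ Finset.range q, g r ^ i * w * g r ^ (q - 1 - i)
        = g r ^ (q - 1) ∧ LinearMap.trace K (W r) w = b r := by
    intro r
    refine exists_sum_conj_eq_of_jordanBlock _ ?_ ((hdim r).trans (hb r)) ?_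
    · obtain ⟨k, hk⟩ := hu
      refine ⟨k, LinearMap.ext fun x ↦ Subtype.ext ?_⟩
      rw [hpow1, hk]; rfl
    · intro h0
      apply hne r
      rw [eq_bot_iff]
      rintro _ ⟨x, hx, rfl⟩
      have := hpow1 r (q * b r - 1) ⟨x, hx⟩
      rw [h0] at this
      rw [hb]
      exact this.symm
  choose w hw hwt using hblock
  let E := LinearEquiv.ofBijective (DirectSum.coeLinearMap W) hW
  let pr : ∀ r, V →ₗ[K] W r := fun r ↦ DirectSum.component K _ _ r ∘ₗ E.symm.toLinearMap
  have hE : ∀ s (x : W s), E.symm x = DirectSum.lof K _ (fun r ↦ W r) s x := by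
    intro s x
    rw [LinearEquiv.symm_apply_eq]
    exact (DirectSum.coeLinearMap_lof W s x).symm
  have hpr : ∀ r (x : W r), pr r x = x := by
    intro r x
    simp only [pr, LinearMap.comp_apply, LinearEquiv.coe_coe, hE]
    exact DirectSum.component.lof_self K (M := fun r ↦ W r) r x
  have hpr' : ∀ r s (x : W s), s ≠ r → pr r x = 0 := by
    intro r s x hsr
    simp only [pr, LinearMap.comp_apply, LinearEquiv.coe_coe, hE]
    rw [DirectSum.component.of, dif_neg hsr]
  have hext : ∀ f g : End K V, (∀ s (x : W s), f x = g x) → f = g := by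
    intro f g h
    have htop : (⊤ : Submodule K V) ≤ LinearMap.eqLocus f g := by
      rw [← hW.submodule_iSup_eq_top, iSup_le_iff]
      exact fun s x hx ↦ h s ⟨x, hx⟩
    exact LinearMap.ext fun x ↦ htop Submodule.mem_top
  refine ⟨fun r ↦ (W r).subtype ∘ₗ w r ∘ₗ pr r, fun r ↦ (W r).subtype ∘ₗ pr r, ?_, ?_, ?_, ?_, ?_⟩
  · intro r
    refine hext _ _ fun s x ↦ ?_
    have hx : ∀ k, (u ^ k) x = ((g s ^ k) x : V) :=
      fun k ↦ (hpow s k x).symm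
    simp only [LinearMap.sum_apply, End.mul_apply, LinearMap.comp_apply, hx]
    by_cases hsr : s = r
    · subst hsr
      simp only [hpr, Submodule.subtype_apply]
      have := congrArg (fun z ↦ ((z x : W s) : V)) (hw s)
      simpa only [LinearMap.sum_apply, End.mul_apply, Submodule.coe_sum, hpow] using this
    · simp [hpr' r s _ hsr]
  · intro r
    refine hext _ _ fun s x ↦ ?_
    have hx : u x = (g s x : V) := (hg s x).symm
    simp only [End.mul_apply, LinearMap.comp_apply, hx]
    by_cases hsr : s = r
    · subst hsr
      simp only [hpr, Submodule.subtype_apply, hx]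
    · simp only [hpr' r s _ hsr, map_zero]
  · refine hext _ _ fun s x ↦ ?_
    rw [LinearMap.sum_apply, Finset.sum_eq_single s]
    · simp [hpr]
    · intro r _ hr
      simp [hpr' r s x hr.symm]
    · simp
  · intro r
    have h1 : pr r ∘ₗ (W r).subtype = LinearMap.id := LinearMap.ext fun x ↦ hpr r x
    rw [LinearMap.trace_comp_comm', LinearMap.comp_assoc, h1, LinearMap.comp_id, hwt]
  · rw [← E.finrank_eq, finrank_directSum]
    simp only [hdim]

section Conj

open Module

variable {K V : Type*} [Field K] [AddCommGroup V] [Module K V] (u : V ≃ₗ[K] V)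

theorem LinearEquiv.conj_pow_apply (i : ℕ) (A : End K V) :
    ((u.conj.toLinearMap : End K (End K V)) ^ i) A * u.toLinearMap ^ i = u.toLinearMap ^ i * A := by
  induction i generalizing A with
  | zero => simp
  | succ i ih =>
    rw [pow_succ, End.mul_apply, pow_succ, ← mul_assoc, ih]
    rw [mul_assoc, mul_assoc]
    congr 1
    ext x
    simp [LinearEquiv.conj_apply]

theorem LinearEquiv.conj_mul (A B : End K V) : u.conj (A * B) = u.conj A * u.conj B := by
  ext x; simp [LinearEquiv.conj_apply]

theorem LinearEquiv.conj_sub_one_apply_eq_zero_iff (A : End K V) :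
    (u.conj.toLinearMap - 1 : End K (End K V)) A = 0 ↔ u.toLinearMap * A = A * u.toLinearMap := by
  rw [LinearMap.sub_apply, sub_eq_zero, End.one_apply]
  have h := u.conj_pow_apply 1 A
  rw [pow_one, pow_one] at h
  refine ⟨fun h' ↦ by rw [← h, h'], fun h' ↦ ?_⟩
  rw [h'] at h
  ext x
  simpa using LinearMap.congr_fun h (u.symm x)

theorem sub_one_pow_char_pow_sub_one {p : ℕ} [Fact p.Prime] [CharP K p] (α : ℕ) {W : Type*}
    [AddCommGroup W] [Module K W] (φ : End K W) :
    (φ - 1) ^ (p ^ α - 1) = ∑ i ∈ Finset.range (p ^ α), φ ^ i := by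
  open Polynomial in
  have h : (X - 1 : K[X]) ^ (p ^ α - 1) = ∑ i ∈ Finset.range (p ^ α), X ^ i := by
    have hX : (X - 1 : K[X]) ≠ 0 := by simpa using X_sub_C_ne_zero (1 : K)
    apply mul_right_cancel₀ hX
    rw [← pow_succ, Nat.sub_add_cancel (Nat.one_le_pow _ _ (Fact.out : p.Prime).pos),
      sub_pow_char_pow, geom_sum_mul, one_pow]
  simpa using congrArg (Polynomial.aeval φ) h

theorem sub_one_pow_char_pow {p : ℕ} [Fact p.Prime] [CharP K p] (α : ℕ) {W : Type*}
    [AddCommGroup W] [Module K W] (φ : End K W) :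
    (φ - 1) ^ (p ^ α) = φ ^ (p ^ α) - 1 := by
  open Polynomial in
  have h : (X - 1 : K[X]) ^ (p ^ α) = X ^ (p ^ α) - 1 := by
    rw [sub_pow_char_pow, one_pow]
  simpa using congrArg (Polynomial.aeval φ) h

theorem conj_sub_one_pow_apply_eq {p : ℕ} [Fact p.Prime] [CharP K p] {α : ℕ} {P π : End K V}
    (hP : ∑ i ∈ Finset.range (p ^ α), u.toLinearMap ^ i * P * u.toLinearMap ^ (p ^ α - 1 - i)
      = u.toLinearMap ^ (p ^ α - 1) * π) (hπ : u.toLinearMap * π = π * u.toLinearMap) :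
    ((u.conj.toLinearMap - 1 : End K (End K V)) ^ (p ^ α - 1)) P = π := by
  rw [sub_one_pow_char_pow_sub_one, LinearMap.sum_apply]
  have hunit : IsUnit (u.toLinearMap : End K V) :=
    (End.isUnit_iff _).2 u.bijective
  apply (hunit.pow (p ^ α - 1)).mul_right_cancel
  rw [(Commute.pow_left hπ (p ^ α - 1)).eq] at hP
  rw [← hP, Finset.sum_mul]
  refine Finset.sum_congr rfl fun i hi ↦ ?_
  rw [← u.conj_pow_apply, mul_assoc, ← pow_add]
  congr 2
  have := Finset.mem_range.1 hi
  omega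

theorem conj_pow_mul_of_commute {a : End K V} (ha : u.conj a = a) (w : End K V) (i : ℕ) :
    ((u.conj.toLinearMap : End K (End K V)) ^ i) (w * a) =
      ((u.conj.toLinearMap : End K (End K V)) ^ i) w * a := by
  induction i with
  | zero => simp
  | succ i ih =>
    rw [pow_succ', End.mul_apply, ih, End.mul_apply, LinearEquiv.coe_coe, u.conj_mul, ha]

theorem ker_conj_sub_one_le_range {p : ℕ} [Fact p.Prime] [CharP K p] {α : ℕ} {w : End K V}
    (hw : ((u.conj.toLinearMap - 1 : End K (End K V)) ^ (p ^ α - 1)) w = 1) :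
    LinearMap.ker (u.conj.toLinearMap - 1 : End K (End K V)) ≤
      LinearMap.range ((u.conj.toLinearMap - 1 : End K (End K V)) ^ (p ^ α - 1)) := by
  intro a ha
  rw [LinearMap.mem_ker, LinearMap.sub_apply, sub_eq_zero] at ha
  refine ⟨w * a, ?_⟩
  rw [sub_one_pow_char_pow_sub_one, LinearMap.sum_apply] at hw ⊢
  rw [Finset.sum_congr rfl fun i _ ↦ conj_pow_mul_of_commute u ha w i, ← Finset.sum_mul, hw,
    one_mul]

theorem one_notMem_range_conj_sub_one_pow {p : ℕ} [Fact p.Prime] [CharP K p] {α : ℕ} {a : End K V}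
    (ha : ((u.conj.toLinearMap - 1 : End K (End K V)) ^ (p ^ α)) a = 0)
    (hta : LinearMap.trace K V a ≠ 0) :
    (1 : End K V) ∉
      LinearMap.range ((u.conj.toLinearMap - 1 : End K (End K V)) ^ (p ^ α)) := by
  rintro ⟨z, hz⟩
  apply hta
  rw [sub_one_pow_char_pow, LinearMap.sub_apply, sub_eq_zero, End.one_apply] at ha
  rw [sub_one_pow_char_pow, LinearMap.sub_apply, End.one_apply] at hz
  set q := p ^ α
  have h1 := u.conj_pow_apply q a
  have h2 := u.conj_pow_apply q z
  rw [ha] at h1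
  have hunit : IsUnit ((u.toLinearMap : End K V) ^ q) :=
    ((End.isUnit_iff _).2 u.bijective).pow q
  obtain ⟨U, hU⟩ := hunit
  rw [← hU] at h1 h2
  have h3 := (Units.eq_mul_inv_iff_mul_eq U).2 h2
  have h4 : a * (U * z * ↑U⁻¹) = U * (a * z) * ↑U⁻¹ := by
    rw [← mul_assoc, ← mul_assoc, ← mul_assoc, h1]
  rw [← mul_one a, ← hz, mul_sub, map_sub, h3, h4, LinearMap.trace_conj, sub_self]

end Conj

theorem jordanBlocks_eq_of_finrank_ker_eq {K V : Type*} [Field K] [AddCommGroup V] [Module K V]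
    {g : Module.End K V} {k : ℕ → ℕ}
    (hk : ∀ m, Module.finrank K (LinearMap.ker ((g - 1 : Module.End K V) ^ m)) = k m) (m : ℕ) :
    jordanBlocks g m = 2 * (k m : ℤ) - k (m + 1) - k (m - 1) := by
  rw [← hk, ← hk, ← hk]
  rfl

theorem stmt13 {K V : Type*} [Field K] [IsAlgClosed K] {p : ℕ} [Fact p.Prime] [CharP K p]
    [AddCommGroup V] [Module K V] [FiniteDimensional K V]
    (n : ℕ) (hn : 2 ≤ n) (hdim : Module.finrank K V = n) (hpn : p ∣ n)
    (u : V ≃ₗ[K] V) (hu : IsNilpotent (u.toLinearMap - 1))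
    {t : ℕ} (ht : 1 ≤ t) (d : Fin t → ℕ) (hd : ∀ r, 1 ≤ d r)
    (hJ : IsJordanTypeOf u.toLinearMap d)
    (α : ℕ) (hα : α = padicValNat p (Finset.univ.gcd d)) (hα0 : 0 < α)
    -- `sl` is the subspace of trace-zero endomorphisms; `S` is the subspace of scalar
    -- multiples of the identity inside `sl` (as a pullback; `p ∣ n` implies `id ∈ sl`);
    -- `u₁` is the restriction of the conjugation action `u.conj` to `sl`, and `u₀''`
    -- is the induced action on the quotient `sl ⧸ S ≅ L(ϖ₁ + ϖ_{n−1})`.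
    (u₁ : ↥(LinearMap.ker (LinearMap.trace K V)) →ₗ[K]
      ↥(LinearMap.ker (LinearMap.trace K V)))
    (hu₁ : ∀ A : ↥(LinearMap.ker (LinearMap.trace K V)),
      ((u₁ A : V →ₗ[K] V)) = u.conj (A : V →ₗ[K] V))
    (u₀'' : (↥(LinearMap.ker (LinearMap.trace K V)) ⧸
        (Submodule.span K {(1 : V →ₗ[K] V)}).comap
          (LinearMap.ker (LinearMap.trace K V)).subtype) →ₗ[K]
      (↥(LinearMap.ker (LinearMap.trace K V)) ⧸
        (Submodule.span K {(1 : V →ₗ[K] V)}).comap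
          (LinearMap.ker (LinearMap.trace K V)).subtype))
    (hu₀'' : ∀ A : ↥(LinearMap.ker (LinearMap.trace K V)),
      u₀'' (Submodule.Quotient.mk A) = Submodule.Quotient.mk (u₁ A)) :
    -- (a)
    (p ∣ n / p ^ α →
      jordanBlocks u₀'' (p ^ α) = jordanBlocks u.conj.toLinearMap (p ^ α) - 2 ∧
      jordanBlocks u₀'' (p ^ α - 1) = 2 ∧
      ∀ m, 1 ≤ m → m ≠ p ^ α → m ≠ p ^ α - 1 →
        jordanBlocks u₀'' m = jordanBlocks u.conj.toLinearMap m) ∧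
    -- (b)
    (¬ p ∣ n / p ^ α → 2 < p ^ α →
      jordanBlocks u₀'' (p ^ α) = jordanBlocks u.conj.toLinearMap (p ^ α) - 1 ∧
      jordanBlocks u₀'' (p ^ α - 2) = 1 ∧
      ∀ m, 1 ≤ m → m ≠ p ^ α → m ≠ p ^ α - 2 →
        jordanBlocks u₀'' m = jordanBlocks u.conj.toLinearMap m) ∧
    -- (c)
    (¬ p ∣ n / p ^ α → p ^ α = 2 →
      jordanBlocks u₀'' 2 = jordanBlocks u.conj.toLinearMap 2 - 1 ∧
      ∀ m, 1 ≤ m → m ≠ 2 →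
        jordanBlocks u₀'' m = jordanBlocks u.conj.toLinearMap m) := by
  classical
  have hp : p.Prime := Fact.out
  set q := p ^ α with hq
  have hq1 : 1 < q := Nat.one_lt_pow hα0.ne' hp.one_lt
  have hgcd : Finset.univ.gcd d ≠ 0 := by
    intro h
    have := Finset.gcd_eq_zero_iff.1 h ⟨0, ht⟩ (Finset.mem_univ _)
    have := hd ⟨0, ht⟩
    omega
  have hdvd : ∀ r, q ∣ d r := fun r ↦ by
    have : q ∣ Finset.univ.gcd d := hq ▸ hα ▸ pow_padicValNat_dvd
    exact this.trans (Finset.gcd_dvd (Finset.mem_univ r))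
  choose b hb using hdvd
  obtain ⟨r₀, hr₀⟩ : ∃ r, ¬ p ∣ b r := by
    by_contra! h
    have h1 : p ^ (α + 1) ∣ Finset.univ.gcd d := by
      refine Finset.dvd_gcd fun r _ ↦ ?_
      rw [hb, pow_succ]
      exact mul_dvd_mul_left _ (h r)
    have := (padicValNat_dvd_iff_le hgcd).1 h1
    omega
  obtain ⟨P, π, hP, hπ, hπ1, htr, hsum⟩ := exists_sum_conj_eq_of_isJordanTypeOf hu hJ hb
  have hnq : n / q = ∑ r, b r := by
    rw [← hdim, hsum]
    simp only [hb, ← Finset.mul_sum]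
    exact Nat.mul_div_cancel_left _ (by omega)
  set N : Module.End K (Module.End K V) := u.conj.toLinearMap - 1 with hN
  have hNP : ∀ r, (N ^ (q - 1)) (P r) = π r := fun r ↦ conj_sub_one_pow_apply_eq u (hP r) (hπ r)
  set w := ∑ r, P r with hwdef
  have hw : (N ^ (q - 1)) w = 1 := by rw [hwdef, map_sum]; simp only [hNP, hπ1]
  have htw : LinearMap.trace K V w = ((n / q : ℕ) : K) := by
    rw [hwdef, map_sum, hnq]; simp only [htr, Nat.cast_sum]
  have hker : LinearMap.ker N ≤ LinearMap.range (N ^ (q - 1)) := ker_conj_sub_one_le_range u hw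
  have hPq : (N ^ q) (P r₀) = 0 := by
    have : N ^ q = N * N ^ (q - 1) := by rw [← pow_succ']; congr 1; omega
    rw [this, Module.End.mul_apply, hNP]
    exact (u.conj_sub_one_apply_eq_zero_iff _).2 (hπ r₀)
  have htP : LinearMap.trace K V (P r₀) ≠ 0 := by
    rw [htr, Ne, CharP.cast_eq_zero_iff K p]; exact hr₀
  have hone := one_notMem_range_conj_sub_one_pow u hPq htP
  have : Nontrivial V := Module.nontrivial_of_finrank_pos (R := K) (by omega)
  have h1 : (1 : Module.End K V) ≠ 0 := one_ne_zero
  have hf1 : LinearMap.trace K V 1 = 0 := by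
    rw [LinearMap.trace_one, hdim, CharP.cast_eq_zero_iff K p]; exact hpn
  have hfN : ∀ x, LinearMap.trace K V (N x) = 0 := fun x ↦ by
    rw [hN, LinearMap.sub_apply, map_sub, LinearEquiv.coe_coe, LinearMap.trace_conj',
      Module.End.one_apply, sub_self]
  have hN₁ : ∀ A, (((u₁ - 1 : Module.End K (LinearMap.ker (LinearMap.trace K V))) A :
      LinearMap.ker (LinearMap.trace K V)) : Module.End K V) = N A := fun A ↦ by
    simp only [LinearMap.sub_apply, Submodule.coe_sub, hu₁, hN, Module.End.one_apply,
      LinearEquiv.coe_coe]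
  have hN₂ : ∀ A, (u₀'' - 1 : Module.End K _) (Submodule.Quotient.mk A) =
      Submodule.Quotient.mk ((u₁ - 1 : Module.End K _) A) := fun A ↦ by
    rw [LinearMap.sub_apply, hu₀'', LinearMap.sub_apply, Submodule.Quotient.mk_sub,
      Module.End.one_apply, Module.End.one_apply]
  have hlt (m : ℕ) (hm : m + 1 < q) :=
    finrank_ker_subquotient_of_lt h1 hf1 hfN hker hw hN₁ hN₂ (m := m) (by omega) (Or.inl hm)
  have heq₀ (m : ℕ) (hm : m + 1 = q) (h : p ∣ n / q) :=
    finrank_ker_subquotient_of_lt h1 hf1 hfN hker hw hN₁ hN₂ (m := m) (by omega)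
      (Or.inr (by rwa [htw, CharP.cast_eq_zero_iff K p]))
  have heq₁ (m : ℕ) (hm : m + 1 = q) (h : ¬ p ∣ n / q) :=
    finrank_ker_subquotient_of_add_one_eq h1 hf1 hw hN₁ hN₂ hm
      (by rwa [htw, Ne, CharP.cast_eq_zero_iff K p])
  have hge (m : ℕ) (hm : q ≤ m) :=
    finrank_ker_subquotient_of_le h1 hf1 hPq htP hone hN₁ hN₂ hm
  have hlin (m : ℕ) (hm : m < q) := finrank_ker_pow_succ_s13 hker hm
  have hlin' (m : ℕ) (hm : 1 ≤ m) (hmq : m ≤ q) :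
      Module.finrank K (LinearMap.ker (N ^ m)) =
        Module.finrank K (LinearMap.ker (N ^ (m - 1))) + Module.finrank K (LinearMap.ker N) := by
    have h := hlin (m - 1) (by omega)
    rwa [Nat.sub_add_cancel hm] at h
  obtain ⟨k, hk⟩ : ∃ k : ℕ → ℕ, ∀ m, Module.finrank K (LinearMap.ker (N ^ m)) = k m :=
    ⟨_, fun _ ↦ rfl⟩
  obtain ⟨k'', hk''⟩ : ∃ k : ℕ → ℕ, ∀ m, Module.finrank K
      (LinearMap.ker ((u₀'' - 1 : Module.End K _) ^ m)) = k m := ⟨_, fun _ ↦ rfl⟩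
  simp only [hk, hk''] at hlt heq₀ heq₁ hge hlin hlin'
  simp only [jordanBlocks_eq_of_finrank_ker_eq hk, jordanBlocks_eq_of_finrank_ker_eq hk'']
  clear_value q
  refine ⟨fun h ↦ ?_, fun h hq2 ↦ ?_, fun h hq2 ↦ ?_⟩
  · have key (m : ℕ) := And.intro (hlt m) (And.intro (fun hm ↦ heq₀ m hm h) (hge m))
    have key' (m : ℕ) := And.intro (key (m - 1)) (And.intro (key m) (key (m + 1)))
    refine ⟨?_, ?_, fun m hm hm₁ hm₂ ↦ ?_⟩
    · have := key' q; omega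
    · have := key' (q - 1); have := hlin (q - 1); have := hlin' (q - 1); omega
    · have := key' m; omega
  · have key (m : ℕ) := And.intro (hlt m) (And.intro (fun hm ↦ heq₁ m hm h) (hge m))
    have key' (m : ℕ) := And.intro (key (m - 1)) (And.intro (key m) (key (m + 1)))
    refine ⟨?_, ?_, fun m hm hm₁ hm₂ ↦ ?_⟩
    · have := key' q; omega
    · have := key' (q - 2); have := hlin (q - 2); have := hlin' (q - 2); omega
    · have := key' m; omega
  · have key (m : ℕ) := And.intro (hlt m) (And.intro (fun hm ↦ heq₁ m hm h) (hge m))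
    have key' (m : ℕ) := And.intro (key (m - 1)) (And.intro (key m) (key (m + 1)))
    refine ⟨?_, fun m hm hm₁ ↦ ?_⟩
    · have := key' 2; omega
    · have := key' m; omega
end
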